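/- Let n ∈ ℕ, R₀ > 0, 𝓑 = B_{R₀}(0) ⊂ ℝ², and suppose the cavitation configuration ((aᵢ)ᵢ₌₁ⁿ, (vᵢ)ᵢ₌₁ⁿ) is attainable through an evolution of circular cavities; let λ > 1 be given by Σᵢ vᵢ = (λ² − 1)πR₀². Then there exist points ζ₁,…,ζₙ ∈ B_{λR₀}(0), a number ε₀ > 0 with ε₀ < 1, a constant C (depending on n, R₀, the aᵢ and the vᵢ but not on ε), and an injective map u : 𝓑̄ ∖ {a₁,…,aₙ} → ℝ² such that: (i) u belongs to W^{1,p}(𝓑, ℝ²) for every 1 ≤ p < 2 and to H¹_loc(𝓑 ∖ {a₁,…,aₙ}, ℝ²); (ii) u(x) = λx for all x ∈ ∂𝓑; (iii) det Du(x) = 1 for almost every x ∈ 𝓑; (iv) for every ε ∈ (0, ε₀], u maps 𝓑̄ ∖ ⋃ᵢ₌₁ⁿ B_ε(aᵢ) onto B̄_{λR₀}(0) ∖ ⋃ᵢ₌₁ⁿ B_{√(vᵢ/π + ε²)}(ζᵢ) — in particular the cavity opened at each aᵢ is, in the limit ε → 0, an open disk of area vᵢ centered at ζᵢ; and (v) for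 every ε ∈ (0, ε₀], ∫_{𝓑 ∖ ⋃ᵢ B̄_ε(aᵢ)} |Du|²/2 dx ≤ C + (Σᵢ vᵢ)|log ε|. -/

import Mathlib

open scoped BigOperators

/-- A cavitation configuration `(a, v)` attainable through an evolution of circular
cavities: the data of the evolutions `z` (centers) and `L` (radii) with all the
required properties, for the stretch factor `lam`. -/
def IsCircEvolution (n : ℕ) (R₀ lam : ℝ) (a : Fin n → ℂ) (v : Fin n → ℝ)
    (z : Fin n → ℝ → ℂ) (L : Fin n → ℝ → ℝ) : Prop :=
  (∀ i, ContDiffOn ℝ 1 (z i) (Set.Icc 1 lam)) ∧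
  (∀ i, ∀ t ∈ Set.Icc (1:ℝ) lam, 0 ≤ L i t) ∧
  (∀ t ∈ Set.Icc (1:ℝ) lam, ∑ i, Real.pi * L i t ^ 2 = (t ^ 2 - 1) * Real.pi * R₀ ^ 2) ∧
  (∀ i, ContDiffOn ℝ 1 (fun t => L i t ^ 2) (Set.Icc 1 lam)) ∧
  (∀ i, z i 1 = a i) ∧
  (∀ i, L i 1 = 0) ∧
  (∀ i, Real.pi * L i lam ^ 2 = v i) ∧
  (∀ t ∈ Set.Icc (1:ℝ) lam, Pairwise (fun i j =>
    Disjoint (Metric.closedBall (z i t) (L i t)) (Metric.closedBall (z j t) (L j t)))) ∧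
  (∀ t ∈ Set.Icc (1:ℝ) lam, ∀ i, Metric.closedBall (z i t) (L i t) ⊆ Metric.ball (0:ℂ) (t * R₀))

section CavityDeformation

open Set Filter Topology Metric
open scoped NNReal ContDiff

section Flow

/-- A bounded, time-continuous, uniformly Lipschitz vector field has global solutions. -/
theorem exists_isIntegralCurveOn_of_bounded {E : Type*} [NormedAddCommGroup E] [NormedSpace ℝ E]
    [CompleteSpace E] {V : ℝ → E → E} {K L : ℝ≥0} {A B : ℝ}
    (hlip : ∀ t ∈ Icc A B, LipschitzWith K (V t))
    (hcont : ∀ x, ContinuousOn (fun t => V t x) (Icc A B))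
    (hbd : ∀ t ∈ Icc A B, ∀ x, ‖V t x‖ ≤ L) {t₀ : ℝ} (ht₀ : t₀ ∈ Icc A B) (x₀ : E) :
    ∃ X : ℝ → E, X t₀ = x₀ ∧ IsIntegralCurveOn X V (Icc A B) := by
  have h : IsPicardLindelof V (tmin := A) (tmax := B) ⟨t₀, ht₀⟩ x₀ (L * (B - A).toNNReal) 0 L K :=
    { lipschitzOnWith := fun t ht => (hlip t ht).lipschitzOnWith
      continuousOn := fun x _ => hcont x
      norm_le := fun t ht x _ => hbd t ht x
      mul_max_le := by
        have hAB : A ≤ B := ht₀.1.trans ht₀.2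
        simp only [NNReal.coe_mul, NNReal.coe_zero, sub_zero]
        rw [Real.coe_toNNReal _ (by linarith)]
        gcongr
        exact max_le (by linarith [ht₀.1]) (by linarith [ht₀.2]) }
  exact h.exists_eq_forall_mem_Icc_hasDerivWithinAt₀

theorem IsIntegralCurveOn.hasDerivWithinAt_Ici {E : Type*} [NormedAddCommGroup E]
    [NormedSpace ℝ E] {V : ℝ → E → E} {A B : ℝ} {X : ℝ → E}
    (hX : IsIntegralCurveOn X V (Icc A B)) {t : ℝ} (ht : t ∈ Ico A B) :
    HasDerivWithinAt X (V t (X t)) (Ici t) t :=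
  (hX t (Ico_subset_Icc_self ht)).mono_of_mem_nhdsWithin (Icc_mem_nhdsGE_of_mem ht)

theorem IsIntegralCurveOn.hasDerivWithinAt_Iic {E : Type*} [NormedAddCommGroup E]
    [NormedSpace ℝ E] {V : ℝ → E → E} {A B : ℝ} {X : ℝ → E}
    (hX : IsIntegralCurveOn X V (Icc A B)) {t : ℝ} (ht : t ∈ Ioc A B) :
    HasDerivWithinAt X (V t (X t)) (Iic t) t :=
  (hX t (Ioc_subset_Icc_self ht)).mono_of_mem_nhdsWithin (Icc_mem_nhdsLE_of_mem ht)

theorem IsIntegralCurveOn.eqOn_Icc {E : Type*} [NormedAddCommGroup E] [NormedSpace ℝ E]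
    {V : ℝ → E → E} {K : ℝ≥0} {A B : ℝ} (hlip : ∀ t ∈ Icc A B, LipschitzWith K (V t))
    {X Y : ℝ → E} (hX : IsIntegralCurveOn X V (Icc A B)) (hY : IsIntegralCurveOn Y V (Icc A B))
    {t₀ : ℝ} (ht₀ : t₀ ∈ Icc A B) (h : X t₀ = Y t₀) : EqOn X Y (Icc A B) := by
  rw [← Icc_union_Icc_eq_Icc ht₀.1 ht₀.2]
  have hl : Icc A t₀ ⊆ Icc A B := Icc_subset_Icc_right ht₀.2
  have hr : Icc t₀ B ⊆ Icc A B := Icc_subset_Icc_left ht₀.1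
  refine EqOn.union ?_ ?_
  · exact ODE_solution_unique_of_mem_Icc_left (s := fun _ => univ)
      (fun t ht => (hlip t (hl (Ioc_subset_Icc_self ht))).lipschitzOnWith)
      (hX.continuousOn.mono hl)
      (fun t ht => (hX.mono hl).hasDerivWithinAt_Iic ht) (fun _ _ => mem_univ _)
      (hY.continuousOn.mono hl)
      (fun t ht => (hY.mono hl).hasDerivWithinAt_Iic ht) (fun _ _ => mem_univ _) h
  · exact ODE_solution_unique_of_mem_Icc_right (s := fun _ => univ)
      (fun t ht => (hlip t (hr (Ico_subset_Icc_self ht))).lipschitzOnWith)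
      (hX.continuousOn.mono hr)
      (fun t ht => (hX.mono hr).hasDerivWithinAt_Ici ht) (fun _ _ => mem_univ _)
      (hY.continuousOn.mono hr)
      (fun t ht => (hY.mono hr).hasDerivWithinAt_Ici ht) (fun _ _ => mem_univ _) h

/-- Global solutions of linear equations with bounded continuous coefficients. -/
theorem exists_linear_isIntegralCurveOn {E : Type*} [NormedAddCommGroup E] [NormedSpace ℝ E]
    [FiniteDimensional ℝ E] {M : ℝ → E →L[ℝ] E} {K : ℝ≥0} {A B : ℝ} (hAB : A ≤ B)
    (hM : ContinuousOn M (Icc A B)) (hK : ∀ t ∈ Icc A B, ‖M t‖ ≤ K) (y₀ : E) :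
    ∃ y : ℝ → E, y A = y₀ ∧ IsIntegralCurveOn y (fun t x => M t x) (Icc A B) ∧
      ∀ t ∈ Icc A B, ‖y t‖ ≤ ‖y₀‖ * Real.exp (K * (B - A)) := by
  have : CompleteSpace E := FiniteDimensional.complete ℝ E
  set R : ℝ := ‖y₀‖ * Real.exp (K * (B - A)) + 1 with hR
  have hRpos : 0 < R := by positivity
  let χ : ContDiffBump (0 : E) := ⟨R, R + 1, hRpos, by linarith⟩
  let c : E → E := fun y => χ y • y
  have hc : ContDiff ℝ 1 c := χ.contDiff.smul contDiff_id
  have hcs : HasCompactSupport c := χ.hasCompactSupport.smul_right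
  obtain ⟨Kc, hKc⟩ := hc.lipschitzWith_of_hasCompactSupport hcs one_ne_zero
  obtain ⟨Cc, hCc⟩ := hcs.exists_bound_of_continuous hc.continuous
  have hcle : ∀ y, ‖c y‖ ≤ ‖y‖ := by
    intro y
    simp only [c, norm_smul, Real.norm_of_nonneg χ.nonneg]
    exact mul_le_of_le_one_left (norm_nonneg _) χ.le_one
  obtain ⟨y, hy0, hy⟩ := exists_isIntegralCurveOn_of_bounded (V := fun t x => M t (c x))
    (K := K * Kc) (L := K * Cc.toNNReal) (A := A) (B := B)
    (fun t ht => by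
      have h1 : LipschitzWith K (M t) := (M t).lipschitz.weaken (hK t ht)
      exact h1.comp hKc)
    (fun x => hM.clm_apply continuousOn_const)
    (fun t ht x => by
      refine ((M t).le_opNorm _).trans ?_
      simp only [NNReal.coe_mul]
      gcongr
      · exact hK t ht
      · exact (hCc x).trans (Real.le_coe_toNNReal _))
    (left_mem_Icc.2 hAB) y₀
  have hbd : ∀ t ∈ Icc A B, ‖y t‖ ≤ ‖y₀‖ * Real.exp (K * (B - A)) := by
    intro t ht
    have := norm_le_gronwallBound_of_norm_deriv_right_le (f := y) (K := K) (ε := 0) (δ := ‖y₀‖)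
      hy.continuousOn (fun s hs => hy.hasDerivWithinAt_Ici hs) (by rw [hy0])
      (fun s hs => by
        rw [add_zero]
        refine ((M s).le_opNorm _).trans ?_
        gcongr
        · exact hK s (Ico_subset_Icc_self hs)
        · exact hcle _) t ht
    rw [gronwallBound_ε0] at this
    refine this.trans ?_
    gcongr
    exact ht.2
  refine ⟨y, hy0, fun t ht => ?_, hbd⟩
  have h1 : c (y t) = y t := by
    have : χ (y t) = 1 := χ.one_of_mem_closedBall (by
      rw [mem_closedBall_zero_iff]
      exact (hbd t ht).trans (by simp [χ, hR]))
    simp [c, this]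
  simpa only [h1] using hy t ht

/-- A time-dependent planar vector field `V` with spatial derivative `D`, with the uniform
bounds which make its flow globally defined and continuously differentiable. -/
structure IsUniformC1Field (V : ℝ → ℂ → ℂ) (D : ℝ → ℂ → ℂ →L[ℝ] ℂ) (K : ℝ≥0) : Prop where
  cont : ∀ x, Continuous fun t => V t x
  norm_le : ∀ t x, ‖V t x‖ ≤ K
  hasFDerivAt : ∀ t x, HasFDerivAt (V t) (D t x) x
  fderiv_norm_le : ∀ t x, ‖D t x‖ ≤ K
  cont_fderiv : Continuous fun p : ℝ × ℂ => D p.1 p.2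
  unif : ∀ ε > 0, ∃ δ > 0, ∀ t x y, dist x y < δ → ‖D t x - D t y‖ ≤ ε

namespace IsUniformC1Field

variable {V : ℝ → ℂ → ℂ} {D : ℝ → ℂ → ℂ →L[ℝ] ℂ} {K : ℝ≥0}

theorem lipschitz (h : IsUniformC1Field V D K) (t : ℝ) : LipschitzWith K (V t) :=
  lipschitzWith_of_nnnorm_fderiv_le (fun x => (h.hasFDerivAt t x).differentiableAt)
    (fun x => by rw [(h.hasFDerivAt t x).fderiv]; exact h.fderiv_norm_le t x)

theorem taylor (h : IsUniformC1Field V D K) {ε : ℝ} (hε : 0 < ε) :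
    ∃ δ > 0, ∀ t x k, ‖k‖ < δ → ‖V t (x + k) - V t x - D t x k‖ ≤ ε * ‖k‖ := by
  obtain ⟨δ, hδ, H⟩ := h.unif ε hε
  refine ⟨δ, hδ, fun t x k hk => ?_⟩
  have := (convex_ball x δ).norm_image_sub_le_of_norm_hasFDerivWithin_le' (f := V t)
    (f' := D t) (φ := D t x) (x := x) (y := x + k) (C := ε)
    (fun y _ => (h.hasFDerivAt t y).hasFDerivWithinAt)
    (fun y hy => H t y x (mem_ball.1 hy)) (mem_ball_self hδ) (by simpa using hk)
  simpa using this

theorem exists_solution (h : IsUniformC1Field V D K) {A B t₀ : ℝ} (ht₀ : t₀ ∈ Icc A B) (x₀ : ℂ) :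
    ∃ X : ℝ → ℂ, X t₀ = x₀ ∧ IsIntegralCurveOn X V (Icc A B) :=
  exists_isIntegralCurveOn_of_bounded (fun t _ => h.lipschitz t)
    (fun x => (h.cont x).continuousOn) (fun t _ x => h.norm_le t x) ht₀ x₀

theorem det_const {A B : ℝ} {M : ℝ → ℂ →L[ℝ] ℂ} {y w : ℝ → ℂ}
    (hy : IsIntegralCurveOn y (fun t x => M t x) (Icc A B))
    (hw : IsIntegralCurveOn w (fun t x => M t x) (Icc A B))
    (htr : ∀ t ∈ Icc A B, (M t 1).re + (M t Complex.I).im = 0) (t : ℝ) (ht : t ∈ Icc A B) :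
    (y t).re * (w t).im - (y t).im * (w t).re = (y A).re * (w A).im - (y A).im * (w A).re := by
  have key : ∀ s ∈ Icc A B, HasDerivWithinAt
      (fun t => (y t).re * (w t).im - (y t).im * (w t).re) 0 (Icc A B) s := by
    intro s hs
    have hre : ∀ {f : ℝ → ℂ} {f' : ℂ}, HasDerivWithinAt f f' (Icc A B) s →
        HasDerivWithinAt (fun t => (f t).re) f'.re (Icc A B) s := fun h =>
      Complex.reCLM.hasFDerivAt.comp_hasDerivWithinAt s h
    have him : ∀ {f : ℝ → ℂ} {f' : ℂ}, HasDerivWithinAt f f' (Icc A B) s →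
        HasDerivWithinAt (fun t => (f t).im) f'.im (Icc A B) s := fun h =>
      Complex.imCLM.hasFDerivAt.comp_hasDerivWithinAt s h
    have h1 := ((hre (hy s hs)).mul (him (hw s hs))).sub ((him (hy s hs)).mul (hre (hw s hs)))
    refine h1.congr_deriv ?_
    have hlin : ∀ z : ℂ, M s z = (z.re : ℝ) • M s 1 + (z.im : ℝ) • M s Complex.I := by
      intro z
      rw [← map_smul, ← map_smul, ← map_add]
      congr 1
      apply Complex.ext <;> simp
    beta_reduce
    rw [hlin (y s), hlin (w s)]
    simp only [Complex.add_re, Complex.add_im, Complex.real_smul, Complex.mul_re, Complex.mul_im,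
      Complex.ofReal_re, Complex.ofReal_im]
    linear_combination ((y s).re * (w s).im - (y s).im * (w s).re) * htr s hs
  exact constant_of_has_deriv_right_zero (fun s hs => (key s hs).continuousWithinAt)
    (fun s hs => (key s (Ico_subset_Icc_self hs)).mono_of_mem_nhdsWithin
      (Icc_mem_nhdsGE_of_mem hs)) t ht

/-- Differentiability of the flow, with Liouville's theorem. -/
theorem exists_hasFDerivAt_flow (h : IsUniformC1Field V D K) {A B : ℝ} (hAB : A ≤ B)
    {φ : ℂ → ℝ → ℂ} (hφA : ∀ x, φ x A = x) (hφ : ∀ x, IsIntegralCurveOn (φ x) V (Icc A B))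
    (x : ℂ) :
    ∃ Y : ℂ →L[ℝ] ℂ, HasFDerivAt (fun x => φ x B) Y x ∧
      (∀ k, ‖Y k‖ ≤ Real.exp (K * (B - A)) * ‖k‖) ∧
      ((∀ t ∈ Icc A B, (D t (φ x t) 1).re + (D t (φ x t) Complex.I).im = 0) →
        LinearMap.det Y.toLinearMap = 1) := by
  set M : ℝ → ℂ →L[ℝ] ℂ := fun t => D t (φ x t) with hMdef
  have hM : ContinuousOn M (Icc A B) :=
    h.cont_fderiv.comp_continuousOn (continuousOn_id.prodMk (hφ x).continuousOn)
  have hMK : ∀ t ∈ Icc A B, ‖M t‖ ≤ K := fun t _ => h.fderiv_norm_le _ _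
  choose y hyA hy hyb using fun k : ℂ => exists_linear_isIntegralCurveOn hAB hM hMK k
  have hMlip : ∀ t ∈ Icc A B, LipschitzWith K (fun x => M t x) := fun t ht =>
    (M t).lipschitz.weaken (hMK t ht)
  have hB : B ∈ Icc A B := right_mem_Icc.2 hAB
  have hA : A ∈ Icc A B := left_mem_Icc.2 hAB
  have hylin : ∀ k : ℂ, y k B = (k.re : ℝ) • y 1 B + (k.im : ℝ) • y Complex.I B := by
    intro k
    have h2 : IsIntegralCurveOn (fun t => (k.re : ℝ) • y 1 t + (k.im : ℝ) • y Complex.I t)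
        (fun t x => M t x) (Icc A B) := by
      intro t ht
      have := ((hy 1 t ht).const_smul k.re).add ((hy Complex.I t ht).const_smul k.im)
      refine this.congr_deriv ?_
      beta_reduce
      rw [map_add, map_smul, map_smul]
    refine (hy k).eqOn_Icc hMlip h2 hA ?_ hB
    simp only [hyA]
    apply Complex.ext <;> simp
  let Y : ℂ →L[ℝ] ℂ :=
    Complex.reCLM.smulRight (y 1 B) + Complex.imCLM.smulRight (y Complex.I B)
  have hY : ∀ k, Y k = y k B := fun k => by rw [hylin k]; simp [Y]
  refine ⟨Y, ?_, fun k => by rw [hY, mul_comm]; exact hyb k B hB, fun htr => ?_⟩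
  · rw [hasFDerivAt_iff_isLittleO_nhds_zero, Asymptotics.isLittleO_iff]
    intro c hc
    set E₁ := Real.exp (K * (B - A)) with hE₁
    have hE₁pos : 0 < E₁ := Real.exp_pos _
    set G := gronwallBound 0 K 1 (B - A) with hG
    have hGnn : 0 ≤ G := by
      have : gronwallBound 0 (K : ℝ) 1 0 ≤ G :=
        gronwallBound_mono le_rfl zero_le_one K.2 (by linarith)
      rwa [gronwallBound_x0] at this
    have hGlin : ∀ e : ℝ, gronwallBound 0 K e (B - A) = e * G := by
      intro e
      rw [hG]
      simp only [gronwallBound]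
      split_ifs <;> ring
    set ε := c / (E₁ * (G + 1)) with hε
    have hεpos : 0 < ε := by positivity
    obtain ⟨δ, hδ, H⟩ := h.taylor hεpos
    have : ∀ᶠ k : ℂ in 𝓝 0, ‖k‖ < δ / E₁ :=
      (continuous_norm.tendsto' (0 : ℂ) 0 norm_zero).eventually_lt_const (by positivity)
    filter_upwards [this] with k hk
    have hk' : ∀ t ∈ Icc A B, ‖y k t‖ < δ := by
      intro t ht
      refine (hyb k t ht).trans_lt ?_
      rwa [lt_div_iff₀ hE₁pos] at hk
    have hsum : ∀ t ∈ Icc A B, HasDerivWithinAt (fun t => φ x t + y k t)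
        (V t (φ x t) + M t (y k t)) (Icc A B) t := fun t ht => (hφ x t ht).add (hy k t ht)
    have key := dist_le_of_approx_trajectories_ODE (v := V) (K := K) (δ := 0)
      (f := φ (x + k)) (f' := fun t => V t (φ (x + k) t)) (εf := 0)
      (g := fun t => φ x t + y k t) (g' := fun t => V t (φ x t) + M t (y k t))
      (εg := ε * (E₁ * ‖k‖)) (a := A) (b := B)
      (fun t => h.lipschitz t) (hφ _).continuousOn (fun t ht => (hφ _).hasDerivWithinAt_Ici ht)
      (fun t _ => by simp)
      (fun t ht => (hsum t ht).continuousWithinAt)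
      (fun t ht => (hsum t (Ico_subset_Icc_self ht)).mono_of_mem_nhdsWithin
        (Icc_mem_nhdsGE_of_mem ht))
      (fun t ht => by
        have ht' := Ico_subset_Icc_self ht
        rw [dist_comm, dist_eq_norm, ← sub_sub]
        refine (H t (φ x t) (y k t) (hk' t ht')).trans ?_
        have := hyb k t ht'
        gcongr
        linarith) (by simp [hφA, hyA]) B hB
    rw [zero_add, hGlin, dist_eq_norm, ← sub_sub, ← hY] at key
    refine key.trans ?_
    have : ε * (E₁ * ‖k‖) * G = c * ‖k‖ * (G / (G + 1)) := by
      rw [hε]; field_simp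
    rw [this]
    refine mul_le_of_le_one_right (by positivity) ?_
    rw [div_le_one (by linarith)]
    linarith
  · have hdet : LinearMap.det Y.toLinearMap =
        (Y 1).re * (Y Complex.I).im - (Y 1).im * (Y Complex.I).re := by
      rw [← LinearMap.det_toMatrix Complex.basisOneI, Matrix.det_fin_two]
      simp [LinearMap.toMatrix_apply]
      ring
    rw [hdet, hY, hY, det_const (hy 1) (hy Complex.I) htr B hB, hyA, hyA]
    simp

end IsUniformC1Field

end Flow

section Field

open Complex (normSq I)
open scoped ComplexConjugate

/-- A smooth cutoff, equal to `1` on `(-∞, 4κ]` and to `0` on `[5κ, ∞)`. -/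
noncomputable def cutoff (κ h : ℝ) : ℝ := Real.smoothTransition ((5 * κ - h) / κ)

/-- A smooth positive function which is the identity on `[κ, ∞)`. -/
noncomputable def regular (κ h : ℝ) : ℝ :=
  κ + Real.smoothTransition ((2 * h - κ) / κ) * (h - κ)

theorem contDiff_cutoff (κ : ℝ) {k : ℕ∞} : ContDiff ℝ k (cutoff κ) :=
  Real.smoothTransition.contDiff.comp (by fun_prop)

theorem contDiff_deriv_cutoff (κ : ℝ) {k : ℕ} : ContDiff ℝ k (deriv (cutoff κ)) := by
  have h : ContDiff ℝ ((k : WithTop ℕ∞) + 1) (cutoff κ) := by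
    exact_mod_cast contDiff_cutoff κ (k := (k + 1 : ℕ))
  exact h.deriv'

theorem cutoff_eq_one {κ h : ℝ} (hκ : 0 < κ) (hh : h ≤ 4 * κ) : cutoff κ h = 1 :=
  Real.smoothTransition.one_of_one_le (by rw [le_div_iff₀ hκ]; linarith)

theorem cutoff_eq_zero {κ h : ℝ} (hκ : 0 < κ) (hh : 5 * κ ≤ h) : cutoff κ h = 0 :=
  Real.smoothTransition.zero_of_nonpos (div_nonpos_of_nonpos_of_nonneg (by linarith) hκ.le)

theorem deriv_cutoff_eq_zero_of_lt {κ h : ℝ} (hκ : 0 < κ) (hh : h < 4 * κ) :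
    deriv (cutoff κ) h = 0 := by
  have : cutoff κ =ᶠ[𝓝 h] fun _ => 1 := by
    filter_upwards [gt_mem_nhds hh] with y hy using cutoff_eq_one hκ (le_of_lt hy)
  rw [this.deriv_eq, deriv_const]

theorem deriv_cutoff_eq_zero_of_gt {κ h : ℝ} (hκ : 0 < κ) (hh : 5 * κ < h) :
    deriv (cutoff κ) h = 0 := by
  have : cutoff κ =ᶠ[𝓝 h] fun _ => 0 := by
    filter_upwards [lt_mem_nhds hh] with y hy using cutoff_eq_zero hκ (le_of_lt hy)
  rw [this.deriv_eq, deriv_const]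

theorem contDiff_regular (κ : ℝ) {k : ℕ∞} : ContDiff ℝ k (regular κ) := by
  have h1 : ContDiff ℝ k fun h : ℝ => Real.smoothTransition ((2 * h - κ) / κ) :=
    Real.smoothTransition.contDiff.comp (by fun_prop)
  exact contDiff_const.add (h1.mul (by fun_prop))

theorem regular_pos {κ : ℝ} (hκ : 0 < κ) (h : ℝ) : 0 < regular κ h := by
  have h0 := Real.smoothTransition.nonneg ((2 * h - κ) / κ)
  have h1 := Real.smoothTransition.le_one ((2 * h - κ) / κ)
  unfold regular
  rcases le_or_gt h (κ / 2) with hh | hh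
  · rw [Real.smoothTransition.zero_of_nonpos
      (div_nonpos_of_nonpos_of_nonneg (by linarith) hκ.le)]
    linarith
  · nlinarith

theorem regular_eq {κ h : ℝ} (hκ : 0 < κ) (hh : κ ≤ h) : regular κ h = h := by
  unfold regular
  rw [Real.smoothTransition.one_of_one_le (by rw [le_div_iff₀ hκ]; linarith)]
  ring

/-- With `h = s |y|² + c`, this is the rotated gradient of `cutoff (h) * Im F`, where `f = F'`. -/
noncomputable def cutTerm (κ s : ℝ) (y : ℂ) (c : ℝ) (f F : ℂ) : ℂ :=
  cutoff κ (s * normSq y + c) • conj f -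
    (2 * s * deriv (cutoff κ) (s * normSq y + c) * F.im) • (I * y)

theorem cutTerm_eq_conj {κ s : ℝ} {y : ℂ} {c : ℝ} {f F : ℂ} (hκ : 0 < κ)
    (h : s * normSq y + c < 4 * κ) : cutTerm κ s y c f F = conj f := by
  simp [cutTerm, cutoff_eq_one hκ h.le, deriv_cutoff_eq_zero_of_lt hκ h]

theorem cutTerm_eq_zero {κ s : ℝ} {y : ℂ} {c : ℝ} {f F : ℂ} (hκ : 0 < κ)
    (h : 5 * κ < s * normSq y + c) : cutTerm κ s y c f F = 0 := by
  simp [cutTerm, cutoff_eq_zero hκ h.le, deriv_cutoff_eq_zero_of_gt hκ h]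

theorem contDiff_normSq {k : WithTop ℕ∞} : ContDiff ℝ k (normSq : ℂ → ℝ) := by
  have : (normSq : ℂ → ℝ) = fun z => Complex.reCLM z * Complex.reCLM z +
      Complex.imCLM z * Complex.imCLM z := by ext z; simp [Complex.normSq_apply]
  rw [this]
  fun_prop

theorem contDiffAt_cutTerm {Q : Type*} [NormedAddCommGroup Q] [NormedSpace ℝ Q] {κ s : ℝ}
    {y : Q → ℂ} {c : Q → ℝ} {f F : Q → ℂ} {p : Q} (hy : ContDiffAt ℝ 1 y p)
    (hc : ContDiffAt ℝ 1 c p) (hf : ContDiffAt ℝ 1 f p) (hF : ContDiffAt ℝ 1 F p) :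
    ContDiffAt ℝ 1 (fun p => cutTerm κ s (y p) (c p) (f p) (F p)) p := by
  have hh : ContDiffAt ℝ 1 (fun p => s * normSq (y p) + c p) p :=
    (contDiffAt_const.mul (contDiff_normSq.contDiffAt.comp p hy)).add hc
  have h1 : ContDiffAt ℝ 1 (fun p => cutoff κ (s * normSq (y p) + c p)) p :=
    (contDiff_cutoff κ (k := 1)).contDiffAt.comp p hh
  have h2 : ContDiffAt ℝ 1 (fun p => deriv (cutoff κ) (s * normSq (y p) + c p)) p :=
    (contDiff_deriv_cutoff κ (k := 1)).contDiffAt.comp p hh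
  have h3 : ContDiffAt ℝ 1 (fun p => conj (f p)) p := Complex.conjCLE.contDiff.contDiffAt.comp p hf
  have h4 : ContDiffAt ℝ 1 (fun p => (F p).im) p := Complex.imCLM.contDiff.contDiffAt.comp p hF
  exact (h1.smul h3).sub (((contDiffAt_const.mul h2).mul h4).smul (contDiffAt_const.mul hy))

theorem contDiffAt_cutTerm_of_gt {Q : Type*} [NormedAddCommGroup Q] [NormedSpace ℝ Q] {κ s : ℝ}
    {y : Q → ℂ} {c : Q → ℝ} {f F : Q → ℂ} {p : Q} (hκ : 0 < κ) (hy : ContinuousAt y p)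
    (hc : ContinuousAt c p) (h : 5 * κ < s * normSq (y p) + c p) :
    ContDiffAt ℝ 1 (fun p => cutTerm κ s (y p) (c p) (f p) (F p)) p := by
  have hh : ContinuousAt (fun p => s * normSq (y p) + c p) p :=
    (continuousAt_const.mul (Complex.continuous_normSq.continuousAt.comp hy)).add hc
  have : (fun p => cutTerm κ s (y p) (c p) (f p) (F p)) =ᶠ[𝓝 p] fun _ => 0 := by
    filter_upwards [hh.eventually (lt_mem_nhds h)] with p' hp' using cutTerm_eq_zero hκ hp'
  exact contDiffAt_const.congr_of_eventuallyEq this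

/-- Differentiability with vanishing divergence at a point. -/
def IsDivFreeAt (g : ℂ → ℂ) (x : ℂ) : Prop :=
  ∃ D : ℂ →L[ℝ] ℂ, HasFDerivAt g D x ∧ (D 1).re + (D I).im = 0

namespace IsDivFreeAt

variable {g g' : ℂ → ℂ} {x : ℂ}

theorem add (h : IsDivFreeAt g x) (h' : IsDivFreeAt g' x) :
    IsDivFreeAt (fun x => g x + g' x) x := by
  obtain ⟨D, hD, h0⟩ := h
  obtain ⟨D', hD', h0'⟩ := h'
  refine ⟨D + D', hD.add hD', ?_⟩
  simp only [add_apply, Complex.add_re, Complex.add_im]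
  linarith

theorem zero : IsDivFreeAt (fun _ => 0) x := ⟨0, hasFDerivAt_const _ _, by simp⟩

theorem sum {ι : Type*} {s : Finset ι} {g : ι → ℂ → ℂ} (h : ∀ i ∈ s, IsDivFreeAt (g i) x) :
    IsDivFreeAt (fun x => ∑ i ∈ s, g i x) x := by
  classical
  induction s using Finset.induction_on with
  | empty => simpa using zero
  | insert a s ha ih =>
    simp only [Finset.sum_insert ha]
    exact (h a (Finset.mem_insert_self a s)).add
      (ih fun i hi => h i (Finset.mem_insert_of_mem hi))

theorem congr (h : IsDivFreeAt g x) (h' : g' =ᶠ[𝓝 x] g) : IsDivFreeAt g' x := by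
  obtain ⟨D, hD, h0⟩ := h
  exact ⟨D, hD.congr_of_eventuallyEq h', h0⟩

theorem star {f' : ℂ} (h : HasDerivAt g f' x) : IsDivFreeAt (fun x => conj (g x)) x := by
  refine ⟨_, Complex.conjCLE.hasFDerivAt.comp x (h.hasFDerivAt.restrictScalars ℝ), ?_⟩
  simp

theorem cutTerm {κ s : ℝ} {z : ℂ} {c : ℝ} {f F : ℂ → ℂ} {f' : ℂ} (hF : HasDerivAt F (f x) x)
    (hf : HasDerivAt f f' x) :
    IsDivFreeAt (fun x => cutTerm κ s (x - z) c (f x) (F x)) x := by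
  set y := x - z with hy
  have hy' : HasFDerivAt (fun x : ℂ => x - z) (ContinuousLinearMap.id ℝ ℂ) x :=
    (hasFDerivAt_id x).sub_const z
  have hre : HasFDerivAt (fun x : ℂ => (x - z).re) Complex.reCLM x :=
    Complex.reCLM.hasFDerivAt.comp x hy'
  have him : HasFDerivAt (fun x : ℂ => (x - z).im) Complex.imCLM x :=
    Complex.imCLM.hasFDerivAt.comp x hy'
  have hn : HasFDerivAt (fun x : ℂ => s * normSq (x - z) + c)
      (s • (y.re • Complex.reCLM + y.re • Complex.reCLM +
        (y.im • Complex.imCLM + y.im • Complex.imCLM))) x := by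
    simp only [Complex.normSq_apply]
    exact (((hre.mul hre).add (him.mul him)).const_mul s).add_const c
  have hη : HasFDerivAt (fun x => cutoff κ (s * normSq (x - z) + c)) _ x :=
    HasDerivAt.comp_hasFDerivAt (h₂ := cutoff κ) x ((contDiff_cutoff κ (k := 1)).differentiable
      one_ne_zero (s * normSq y + c)).hasDerivAt hn
  have hη' : HasFDerivAt (fun x => deriv (cutoff κ) (s * normSq (x - z) + c)) _ x :=
    HasDerivAt.comp_hasFDerivAt (h₂ := deriv (cutoff κ)) x
      ((contDiff_deriv_cutoff κ (k := 1)).differentiable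
        (by simp) (s * normSq y + c)).hasDerivAt hn
  have hfc : HasFDerivAt (fun x => (starRingEnd ℂ) (f x)) _ x :=
    Complex.conjCLE.hasFDerivAt.comp x (hf.hasFDerivAt.restrictScalars ℝ)
  have hFi : HasFDerivAt (fun x => (F x).im) _ x :=
    Complex.imCLM.hasFDerivAt.comp x (hF.hasFDerivAt.restrictScalars ℝ)
  have hIy : HasFDerivAt (fun x : ℂ => I * (x - z)) _ x := hy'.const_mul I
  refine ⟨_, (hη.smul hfc).sub (((hη'.const_mul (2 * s)).mul hFi).smul hIy), ?_⟩
  simp [← hy]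
  ring

end IsDivFreeAt

end Field

section CavityField

open Complex (normSq I slitPlane)
open scoped ComplexConjugate

variable {n : ℕ}

/-- Complex velocity cancelling, near the `i`-th disk, all sources but the `i`-th one. -/
noncomputable def innerVel (z τ : Fin n → ℂ) (q : Fin n → ℝ) (i : Fin n) (x : ℂ) : ℂ :=
  conj (τ i) - ∑ j ∈ Finset.univ.erase i, q j / (x - z j)

/-- A primitive of `innerVel`. -/
noncomputable def innerPot (z τ : Fin n → ℂ) (q : Fin n → ℝ) (i : Fin n) (x : ℂ) : ℂ :=
  conj (τ i) * (x - z i) -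
    ∑ j ∈ Finset.univ.erase i, q j * Complex.log ((x - z j) / (z i - z j))

/-- Complex velocity turning, near the outer boundary, all sources into one at the origin. -/
noncomputable def outerVel (z : Fin n → ℂ) (q : Fin n → ℝ) (x : ℂ) : ℂ :=
  -∑ j, q j * (1 / (x - z j) - 1 / x)

/-- A primitive of `outerVel`. -/
noncomputable def outerPot (z : Fin n → ℂ) (q : Fin n → ℝ) (x : ℂ) : ℂ :=
  -∑ j, q j * Complex.log (1 - z j / x)

/-- The velocity field realizing the motion of disks with centers `z`, squared radii `m`,
velocities `τ` and area growth rates `2 π q` inside a disk of squared radius `c`. -/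
noncomputable def cavityField (κ : ℝ) (z : Fin n → ℂ) (m : Fin n → ℝ) (τ : Fin n → ℂ)
    (q : Fin n → ℝ) (c : ℝ) (x : ℂ) : ℂ :=
  ∑ j, (q j / (m j + regular κ (normSq (x - z j) - m j))) • (x - z j) +
    ∑ i, cutTerm κ 1 (x - z i) (-m i) (innerVel z τ q i x) (innerPot z τ q i x) +
    cutTerm κ (-1) (x - 0) c (outerVel z q x) (outerPot z q x)

/-- Quantitative separation of the disks from each other and from the outer boundary. -/
structure DisksSeparated (κ : ℝ) (z : Fin n → ℂ) (m : Fin n → ℝ) (c : ℝ) : Prop where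
  nonneg : ∀ i, 0 ≤ m i
  slit : ∀ i j, j ≠ i → ∀ x, normSq (x - z i) - m i < 6 * κ → (x - z j) / (z i - z j) ∈ slitPlane
  far : ∀ i j, j ≠ i → ∀ x, normSq (x - z i) - m i < 6 * κ → 6 * κ ≤ normSq (x - z j) - m j
  far_outer : ∀ i x, normSq (x - z i) - m i < 6 * κ → 6 * κ ≤ c - normSq x
  outer : ∀ x, c - normSq x < 6 * κ → x ≠ 0 ∧ ∀ j, 1 - z j / x ∈ slitPlane

theorem ne_of_far {κ m : ℝ} (hκ : 0 < κ) (hm : 0 ≤ m) {x z : ℂ}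
    (h : κ ≤ normSq (x - z) - m) : x - z ≠ 0 := by
  intro h0
  rw [h0, map_zero] at h
  linarith

theorem hasDerivAt_innerPot {z τ : Fin n → ℂ} {q : Fin n → ℝ} {i : Fin n} {x : ℂ}
    (h : ∀ j, j ≠ i → (x - z j) / (z i - z j) ∈ slitPlane) :
    HasDerivAt (innerPot z τ q i) (innerVel z τ q i x) x := by
  have h1 : HasDerivAt (fun x => conj (τ i) * (x - z i)) (conj (τ i) * 1) x :=
    ((hasDerivAt_id x).sub_const _).const_mul _
  rw [mul_one] at h1
  refine h1.sub (HasDerivAt.fun_sum fun j hj => ?_)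
  have hj' := h j (Finset.ne_of_mem_erase hj)
  have hne := Complex.slitPlane_ne_zero hj'
  have h2 := ((((hasDerivAt_id x).sub_const (z j)).div_const (z i - z j)).clog hj').const_mul
    (q j : ℂ)
  refine h2.congr_deriv ?_
  have ha : x - z j ≠ 0 := fun h => hne (by rw [h, zero_div])
  have hb : z i - z j ≠ 0 := fun h => hne (by rw [h, div_zero])
  simp only [id]
  field_simp

theorem differentiableAt_innerVel {z τ : Fin n → ℂ} {q : Fin n → ℝ} {i : Fin n} {x : ℂ}
    (h : ∀ j, j ≠ i → x - z j ≠ 0) : DifferentiableAt ℂ (innerVel z τ q i) x := by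
  unfold innerVel
  refine (differentiableAt_const _).sub (DifferentiableAt.fun_sum fun j hj => ?_)
  exact (differentiableAt_const _).div (by fun_prop) (h j (Finset.ne_of_mem_erase hj))

theorem hasDerivAt_outerPot {z : Fin n → ℂ} {q : Fin n → ℝ} {x : ℂ} (hx : x ≠ 0)
    (h : ∀ j, 1 - z j / x ∈ slitPlane) :
    HasDerivAt (outerPot z q) (outerVel z q x) x := by
  refine (HasDerivAt.fun_sum fun j _ => ?_).neg
  have h2 := ((((hasDerivAt_id x).fun_inv hx).const_mul (z j)).const_sub 1)
  have hj' : 1 - z j * (id x)⁻¹ ∈ slitPlane := by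
    simpa [div_eq_mul_inv] using h j
  have h3 := (h2.clog hj').const_mul (q j : ℂ)
  simp only [id, ← div_eq_mul_inv] at h3
  refine h3.congr_deriv ?_
  have hne := Complex.slitPlane_ne_zero (h j)
  have hne' : x - z j ≠ 0 := fun h0 => hne (by
    rw [sub_eq_zero] at h0
    rw [← h0, div_self hx, sub_self])
  field_simp
  ring

theorem differentiableAt_outerVel {z : Fin n → ℂ} {q : Fin n → ℝ} {x : ℂ} (hx : x ≠ 0)
    (h : ∀ j, x - z j ≠ 0) : DifferentiableAt ℂ (outerVel z q) x := by
  unfold outerVel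
  refine (DifferentiableAt.fun_sum fun j _ => ?_).neg
  refine (differentiableAt_const _).mul (DifferentiableAt.sub ?_ ?_)
  · exact (differentiableAt_const _).div (by fun_prop) (h j)
  · exact (differentiableAt_const _).div (by fun_prop) hx

namespace DisksSeparated

variable {κ : ℝ} {z : Fin n → ℂ} {m : Fin n → ℝ} {c : ℝ}

theorem far_of_outer (h : DisksSeparated κ z m c) {x : ℂ} (hx : c - normSq x < 6 * κ) (j : Fin n) :
    6 * κ ≤ normSq (x - z j) - m j := by
  by_contra! hj
  exact absurd (h.far_outer j x hj) (not_le.2 hx)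

theorem conj_source {q : ℝ} {w : ℂ} : conj ((q : ℂ) / w) = (q / normSq w) • w := by
  rcases eq_or_ne w 0 with rfl | hw
  · simp
  · have h1 : conj w ≠ 0 := by simpa using hw
    have h2 : (normSq w : ℂ) ≠ 0 := by exact_mod_cast (Complex.normSq_pos.2 hw).ne'
    rw [map_div₀, Complex.conj_ofReal, Complex.real_smul, div_eq_iff h1, mul_assoc,
      Complex.mul_conj]
    push_cast
    field_simp

theorem source_eq (hκ : 0 < κ) {q : ℝ} {j : Fin n} {x : ℂ} (hx : κ ≤ normSq (x - z j) - m j) :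
    (q / (m j + regular κ (normSq (x - z j) - m j))) • (x - z j) = conj ((q : ℂ) / (x - z j)) := by
  rw [regular_eq hκ hx, add_sub_cancel, conj_source]

theorem isDivFreeAt (h : DisksSeparated κ z m c) (hκ : 0 < κ) (τ : Fin n → ℂ) (q : Fin n → ℝ)
    {x : ℂ} (hx : ∀ i, κ < normSq (x - z i) - m i) :
    IsDivFreeAt (cavityField κ z m τ q c) x := by
  have hne : ∀ i, x - z i ≠ 0 := fun i => ne_of_far hκ (h.nonneg i) (hx i).le
  have hcont : ∀ i, Continuous fun x => normSq (x - z i) - m i := fun i =>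
    (Complex.continuous_normSq.comp (continuous_id.sub continuous_const)).sub continuous_const
  have hcont0 : Continuous fun x => c - normSq x := continuous_const.sub Complex.continuous_normSq
  refine (IsDivFreeAt.add (IsDivFreeAt.sum fun j _ => ?_) (IsDivFreeAt.sum fun i _ => ?_)).add ?_
  · have h1 : HasDerivAt (fun x => (q j : ℂ) / (x - z j)) _ x :=
      (hasDerivAt_const x (q j : ℂ)).div ((hasDerivAt_id x).sub_const (z j)) (hne j)
    refine h1 |> IsDivFreeAt.star |>.congr ?_
    filter_upwards [(hcont j).continuousAt.eventually (lt_mem_nhds (hx j))] with w hw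
    exact source_eq hκ hw.le
  · rcases lt_or_ge (normSq (x - z i) - m i) (6 * κ) with hi | hi
    · exact IsDivFreeAt.cutTerm (hasDerivAt_innerPot fun j hj => h.slit i j hj x hi)
        (differentiableAt_innerVel fun j _ => hne j).hasDerivAt
    · refine IsDivFreeAt.zero.congr ?_
      have : 5 * κ < normSq (x - z i) - m i := by linarith
      filter_upwards [(hcont i).continuousAt.eventually (lt_mem_nhds this)] with w hw
      exact cutTerm_eq_zero hκ (by linarith)
  · rcases lt_or_ge (c - normSq x) (6 * κ) with hi | hi
    · obtain ⟨hx0, hs⟩ := h.outer x hi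
      exact IsDivFreeAt.cutTerm (hasDerivAt_outerPot hx0 hs)
        (differentiableAt_outerVel hx0 hne).hasDerivAt
    · refine IsDivFreeAt.zero.congr ?_
      have : 5 * κ < c - normSq x := by linarith
      filter_upwards [hcont0.continuousAt.eventually (lt_mem_nhds this)] with w hw
      exact cutTerm_eq_zero hκ (by rw [sub_zero]; linarith)

theorem cavityField_inner (h : DisksSeparated κ z m c) (hκ : 0 < κ) (τ : Fin n → ℂ) (q : Fin n → ℝ)
    {i : Fin n} {x : ℂ} (hx : κ ≤ normSq (x - z i) - m i) (hx' : normSq (x - z i) - m i < 4 * κ) :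
    cavityField κ z m τ q c x = τ i + (q i / normSq (x - z i)) • (x - z i) := by
  have h6 : normSq (x - z i) - m i < 6 * κ := by linarith
  have hfar : ∀ j, j ≠ i → 6 * κ ≤ normSq (x - z j) - m j := fun j hj => h.far i j hj x h6
  have hall : ∀ j, κ ≤ normSq (x - z j) - m j := by
    intro j
    rcases eq_or_ne j i with rfl | hj
    · exact hx
    · linarith [hfar j hj]
  have h0 : cutTerm κ (-1) (x - 0) c (outerVel z q x) (outerPot z q x) = 0 :=
    cutTerm_eq_zero hκ (by rw [sub_zero]; linarith [h.far_outer i x h6])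
  have h1 : ∑ j, cutTerm κ 1 (x - z j) (-m j) (innerVel z τ q j x) (innerPot z τ q j x) =
      conj (innerVel z τ q i x) := by
    rw [Finset.sum_eq_single i, cutTerm_eq_conj hκ (by linarith)]
    · intro j _ hj
      exact cutTerm_eq_zero hκ (by linarith [hfar j hj])
    · simp
  unfold cavityField
  rw [h0, h1, Finset.sum_congr rfl fun j _ => source_eq hκ (hall j), add_zero,
    ← Finset.add_sum_erase _ _ (Finset.mem_univ i)]
  simp only [innerVel, map_sub, map_sum, Complex.conj_conj]
  rw [conj_source]
  ring

theorem cavityField_outer (h : DisksSeparated κ z m c) (hκ : 0 < κ) (τ : Fin n → ℂ) (q : Fin n → ℝ)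
    {x : ℂ} (hx : c - normSq x < 4 * κ) :
    cavityField κ z m τ q c x = ((∑ j, q j) / normSq x) • x := by
  have h6 : c - normSq x < 6 * κ := by linarith
  have hfar : ∀ j, 6 * κ ≤ normSq (x - z j) - m j := h.far_of_outer h6
  have h0 : cutTerm κ (-1) (x - 0) c (outerVel z q x) (outerPot z q x) = conj (outerVel z q x) :=
    cutTerm_eq_conj hκ (by rw [sub_zero]; linarith)
  have h1 : ∑ j, cutTerm κ 1 (x - z j) (-m j) (innerVel z τ q j x) (innerPot z τ q j x) = 0 :=
    Finset.sum_eq_zero fun j _ => cutTerm_eq_zero hκ (by linarith [hfar j])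
  unfold cavityField
  rw [h0, h1, Finset.sum_congr rfl fun j _ => source_eq hκ (show κ ≤ _ by linarith [hfar j]),
    add_zero, ← map_sum, ← map_add, ← conj_source]
  congr 1
  simp only [outerVel]
  push_cast
  rw [Finset.sum_div, ← sub_eq_add_neg, ← Finset.sum_sub_distrib]
  refine Finset.sum_congr rfl fun j _ => ?_
  ring

end DisksSeparated

/-- The parameters `(z, m, τ, q, c)` of `cavityField`. -/
abbrev CavityParam (n : ℕ) : Type :=
  (Fin n → ℂ) × (Fin n → ℝ) × (Fin n → ℂ) × (Fin n → ℝ) × ℝ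

theorem contDiffAt_cavityField {κ : ℝ} (hκ : 0 < κ) (p : CavityParam n) (x : ℂ)
    (h : DisksSeparated κ p.1 p.2.1 p.2.2.2.2) :
    ContDiffAt ℝ 1 (fun r : CavityParam n × ℂ =>
      cavityField κ r.1.1 r.1.2.1 r.1.2.2.1 r.1.2.2.2.1 r.1.2.2.2.2 r.2) (p, x) := by
  have hz : ∀ i, ContDiff ℝ 1 fun r : CavityParam n × ℂ => r.1.1 i := fun i => by fun_prop
  have hm : ∀ i, ContDiff ℝ 1 fun r : CavityParam n × ℂ => r.1.2.1 i := fun i => by fun_prop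
  have hτ : ∀ i, ContDiff ℝ 1 fun r : CavityParam n × ℂ => conj (r.1.2.2.1 i) := fun i =>
    Complex.conjCLE.contDiff.comp (by fun_prop)
  have hq' : ∀ i, ContDiff ℝ 1 fun r : CavityParam n × ℂ => r.1.2.2.2.1 i := fun i => by fun_prop
  have hq : ∀ i, ContDiff ℝ 1 fun r : CavityParam n × ℂ => (r.1.2.2.2.1 i : ℂ) := fun i =>
    Complex.ofRealCLM.contDiff.comp (hq' i)
  have hc : ContDiff ℝ 1 fun r : CavityParam n × ℂ => r.1.2.2.2.2 := by fun_prop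
  have hx : ContDiff ℝ 1 fun r : CavityParam n × ℂ => r.2 := by fun_prop
  have hy : ∀ i, ContDiff ℝ 1 fun r : CavityParam n × ℂ => r.2 - r.1.1 i := fun i => hx.sub (hz i)
  have hlog : ∀ {g : CavityParam n × ℂ → ℂ}, ContDiffAt ℝ 1 g (p, x) → g (p, x) ∈ slitPlane →
      ContDiffAt ℝ 1 (fun r => Complex.log (g r)) (p, x) := fun hg hs =>
    ((Complex.contDiffAt_log hs).restrict_scalars ℝ).comp (p, x) hg
  have hdiv : ∀ {f g : CavityParam n × ℂ → ℂ}, ContDiffAt ℝ 1 f (p, x) →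
      ContDiffAt ℝ 1 g (p, x) → g (p, x) ≠ 0 → ContDiffAt ℝ 1 (fun r => f r / g r) (p, x) :=
    fun hf hg hne => (hf.mul (hg.inv hne)).congr_of_eventuallyEq
      (.of_forall fun r => div_eq_mul_inv _ _)
  refine ((ContDiffAt.sum fun j _ => ?_).add (ContDiffAt.sum fun i _ => ?_)).add ?_
  · have h1 : ContDiff ℝ 1 fun r : CavityParam n × ℂ =>
        r.1.2.1 j + regular κ (normSq (r.2 - r.1.1 j) - r.1.2.1 j) :=
      (hm j).add ((contDiff_regular κ (k := 1)).comp ((contDiff_normSq.comp (hy j)).sub (hm j)))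
    refine ((hq' j).contDiffAt.div h1.contDiffAt ?_).smul (hy j).contDiffAt
    have := h.nonneg j
    have := regular_pos hκ (normSq (x - p.1 j) - p.2.1 j)
    simp only
    positivity
  · rcases lt_or_ge (normSq (x - p.1 i) - p.2.1 i) (6 * κ) with hi | hi
    · have hs := fun j hj => h.slit i j hj x hi
      refine contDiffAt_cutTerm (hy i).contDiffAt (hm i).neg.contDiffAt ?_ ?_
      · refine (hτ i).contDiffAt.sub (ContDiffAt.sum fun j hj => ?_)
        refine hdiv (hq j).contDiffAt (hy j).contDiffAt ?_
        have hne := Complex.slitPlane_ne_zero (hs j (Finset.ne_of_mem_erase hj))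
        exact fun h => hne (by simp only at h; rw [h, zero_div])
      · refine ((hτ i).mul (hy i)).contDiffAt.sub (ContDiffAt.sum fun j hj => ?_)
        have hs' := hs j (Finset.ne_of_mem_erase hj)
        have hne := Complex.slitPlane_ne_zero hs'
        refine (hq j).contDiffAt.mul (hlog ?_ hs')
        refine hdiv (hy j).contDiffAt ((hz i).sub (hz j)).contDiffAt ?_
        exact fun h => hne (by simp only at h; rw [h, div_zero])
    · exact contDiffAt_cutTerm_of_gt hκ (hy i).continuous.continuousAt
        (hm i).neg.continuous.continuousAt (by simp only; linarith)
  · have hx0 : ContDiff ℝ 1 fun r : CavityParam n × ℂ => r.2 - 0 := hx.sub contDiff_const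
    rcases lt_or_ge (p.2.2.2.2 - normSq x) (6 * κ) with hi | hi
    · obtain ⟨hx0', hs⟩ := h.outer x hi
      have hne : ∀ j, x - p.1 j ≠ 0 := fun j =>
        ne_of_far (κ := 6 * κ) (by linarith) (h.nonneg j) (h.far_of_outer hi j)
      refine contDiffAt_cutTerm hx0.contDiffAt hc.contDiffAt ?_ ?_
      · refine (ContDiffAt.sum fun j _ => (hq j).contDiffAt.mul (ContDiffAt.sub ?_ ?_)).neg
        · exact hdiv contDiffAt_const (hy j).contDiffAt (hne j)
        · exact hdiv contDiffAt_const hx.contDiffAt hx0'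
      · refine (ContDiffAt.sum fun j _ => (hq j).contDiffAt.mul (hlog ?_ (hs j))).neg
        exact contDiffAt_const.sub (hdiv (hz j).contDiffAt hx.contDiffAt hx0')
    · exact contDiffAt_cutTerm_of_gt hκ hx0.continuous.continuousAt hc.continuous.continuousAt
        (by simp only [sub_zero]; linarith)

end CavityField

section Evolution

open Complex (normSq I)

variable {n : ℕ}

theorem DisksSeparated.of_dist {z : Fin n → ℂ} {L : Fin n → ℝ} {ρ δ κ : ℝ} (hδ : 0 < δ)
    (hκ : 6 * κ ≤ δ ^ 2) (hL : ∀ i, 0 ≤ L i) (hρ : 2 * δ ≤ ρ)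
    (hz : ∀ i j, j ≠ i → L i + L j + 2 * δ ≤ dist (z i) (z j))
    (h0 : ∀ i, ‖z i‖ + L i + 2 * δ ≤ ρ) :
    DisksSeparated κ z (fun i => L i ^ 2) (ρ ^ 2) := by
  have hin : ∀ i x, normSq (x - z i) - L i ^ 2 < 6 * κ → ‖x - z i‖ < L i + δ := by
    intro i x hx
    rw [Complex.normSq_eq_norm_sq] at hx
    refine lt_of_pow_lt_pow_left₀ 2 (by linarith [hL i]) ?_
    nlinarith [hL i]
  have hout : ∀ x, ρ ^ 2 - normSq x < 6 * κ → ρ - δ < ‖x‖ := by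
    intro x hx
    rw [Complex.normSq_eq_norm_sq] at hx
    refine lt_of_pow_lt_pow_left₀ 2 (norm_nonneg _) ?_
    nlinarith
  refine ⟨fun i => sq_nonneg _, ?_, ?_, ?_, ?_⟩
  · intro i j hj x hx
    have h1 := hin i x hx
    have h2 := hz i j hj
    rw [dist_eq_norm] at h2
    have h3 : 0 < ‖z i - z j‖ := by linarith [hL i, hL j]
    have h4 : z i - z j ≠ 0 := norm_pos_iff.1 h3
    have h5 : (x - z j) / (z i - z j) = 1 + (x - z i) / (z i - z j) := by
      field_simp
      ring
    rw [h5]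
    apply Complex.mem_slitPlane_of_norm_lt_one
    rw [norm_div, div_lt_one h3]
    linarith [hL j]
  · intro i j hj x hx
    have h1 := hin i x hx
    have h2 := hz i j hj
    have h3 : dist (z i) (z j) ≤ ‖x - z i‖ + ‖x - z j‖ := by
      rw [← dist_eq_norm, ← dist_eq_norm, dist_comm x (z i)]
      exact dist_triangle _ _ _
    rw [Complex.normSq_eq_norm_sq]
    have h4 : L j + δ ≤ ‖x - z j‖ := by linarith
    nlinarith [hL j]
  · intro i x hx
    have h1 := hin i x hx
    have h2 := h0 i
    have h3 : ‖x‖ ≤ ‖x - z i‖ + ‖z i‖ := by simpa using norm_add_le (x - z i) (z i)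
    rw [Complex.normSq_eq_norm_sq]
    nlinarith [norm_nonneg x]
  · intro x hx
    have h1 := hout x hx
    have hx0 : 0 < ‖x‖ := by linarith
    refine ⟨norm_pos_iff.1 hx0, fun j => ?_⟩
    rw [sub_eq_add_neg]
    apply Complex.mem_slitPlane_of_norm_lt_one
    rw [norm_neg, norm_div, div_lt_one hx0]
    linarith [h0 j, hL j]

theorem exists_pos_forall_le {ι α : Type*} [Finite ι] [TopologicalSpace α] {s : Set α}
    (hs : IsCompact s) {f : ι → α → ℝ} (hf : ∀ i, ContinuousOn (f i) s)
    (hpos : ∀ i, ∀ t ∈ s, 0 < f i t) : ∀ᶠ δ in 𝓝[>] (0 : ℝ), ∀ i, ∀ t ∈ s, δ ≤ f i t := by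
  rw [eventually_all]
  intro i
  rcases s.eq_empty_or_nonempty with rfl | hne
  · simp
  obtain ⟨t₀, ht₀, hmin⟩ := hs.exists_isMinOn hne (hf i)
  filter_upwards [Ioo_mem_nhdsGT (hpos i t₀ ht₀)] with δ hδ t ht
  exact hδ.2.le.trans (hmin ht)

theorem IsCircEvolution.exists_separated {R₀ lam : ℝ} {a : Fin n → ℂ} {v : Fin n → ℝ}
    {z : Fin n → ℝ → ℂ} {L : Fin n → ℝ → ℝ} (hR₀ : 0 < R₀)
    (h : IsCircEvolution n R₀ lam a v z L) :
    ∃ κ > 0, κ < 1 / 4 ∧ ∀ t ∈ Icc 1 lam,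
      DisksSeparated κ (fun i => z i t) (fun i => L i t ^ 2) ((t * R₀) ^ 2) := by
  obtain ⟨hz, hL, -, hm, -, -, -, hdisj, hsub⟩ := h
  have hLc : ∀ i, ContinuousOn (L i) (Icc 1 lam) := fun i =>
    ((hm i).continuousOn.sqrt).congr fun t ht => (Real.sqrt_sq (hL i t ht)).symm
  have hzc := fun i => (hz i).continuousOn
  have e1 := exists_pos_forall_le (ι := {p : Fin n × Fin n // p.2 ≠ p.1}) isCompact_Icc
    (f := fun p t => (‖z p.1.1 t - z p.1.2 t‖ - L p.1.1 t - L p.1.2 t) / 2)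
    (fun p => (((((hzc _).sub (hzc _)).norm).sub (hLc _)).sub (hLc _)).div_const 2)
    (fun p t ht => by
      have := (disjoint_closedBall_closedBall_iff (hL _ t ht) (hL _ t ht)).1
        (hdisj t ht p.2.symm)
      rw [dist_eq_norm] at this
      linarith)
  have e2 := exists_pos_forall_le isCompact_Icc
    (f := fun i t => (t * R₀ - ‖z i t‖ - L i t) / 2)
    (fun i => (((continuousOn_id.mul continuousOn_const).sub (hzc i).norm).sub
      (hLc i)).div_const 2) (fun i t ht => by
      have hR : 0 < t * R₀ := mul_pos (by linarith [ht.1]) hR₀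
      have h1 := hsub t ht i
      have hLi := hL i t ht
      have h2 : ‖z i t‖ + L i t < t * R₀ := by
        rcases eq_or_ne (z i t) 0 with h0 | h0
        · have : ((L i t : ℝ) : ℂ) ∈ closedBall (z i t) (L i t) := by
            simp [h0, abs_of_nonneg hLi]
          have := h1 this
          simpa [h0, abs_of_nonneg hLi] using this
        · have hn : 0 < ‖z i t‖ := norm_pos_iff.2 h0
          have : z i t + (L i t / ‖z i t‖) • z i t ∈ closedBall (z i t) (L i t) := by
            rw [mem_closedBall, dist_eq_norm, add_sub_cancel_left, norm_smul, Real.norm_eq_abs,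
              abs_of_nonneg (by positivity), div_mul_cancel₀ _ hn.ne']
          have := h1 this
          rw [mem_ball_zero_iff,
            show z i t + (L i t / ‖z i t‖) • z i t = (1 + L i t / ‖z i t‖) • z i t by
            rw [add_smul, one_smul], norm_smul, Real.norm_eq_abs, abs_of_nonneg (by positivity),
            add_mul, one_mul, div_mul_cancel₀ _ hn.ne'] at this
          exact this
      linarith)
  obtain ⟨δ, ⟨⟨h1, h2⟩, h3⟩, h4⟩ := (((e1.and e2).and (Ioo_mem_nhdsGT
    (show (0 : ℝ) < min 1 (R₀ / 2) by positivity))).and self_mem_nhdsWithin).exists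
  have hδ : 0 < δ := h4
  have hδ1 : δ < 1 := h3.2.trans_le (min_le_left _ _)
  have hδR : δ < R₀ / 2 := h3.2.trans_le (min_le_right _ _)
  refine ⟨δ ^ 2 / 6, by positivity, by nlinarith, fun t ht => ?_⟩
  refine DisksSeparated.of_dist hδ (by linarith) (fun i => hL i t ht) ?_ ?_ ?_
  · nlinarith [ht.1]
  · intro i j hj
    rw [dist_eq_norm]
    linarith [h1 ⟨(i, j), hj⟩ t ht]
  · intro i
    linarith [h2 i t ht]

theorem exists_isUniformC1Field {P : Type*} [NormedAddCommGroup P] [NormedSpace ℝ P]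
    {F : P × ℂ → ℂ} {γ : ℝ → P} {A B ρ : ℝ} (hAB : A ≤ B) (hγ : ContinuousOn γ (Icc A B))
    (hF : ∀ t ∈ Icc A B, ∀ x, ContDiffAt ℝ 1 F (γ t, x)) (hρ : 0 < ρ) :
    ∃ V D K, IsUniformC1Field V D K ∧ ∀ t ∈ Icc A B, ∀ x, ‖x‖ ≤ ρ → V t x = F (γ t, x) := by
  let b : ContDiffBump (0 : ℂ) := ⟨ρ, ρ + 1, hρ, by linarith⟩
  set G : P × ℂ → ℂ := fun p => b p.2 • F p with hG
  have hGd : ∀ t ∈ Icc A B, ∀ x, ContDiffAt ℝ 1 G (γ t, x) := fun t ht x =>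
    (b.contDiff.contDiffAt.comp _ contDiffAt_snd).smul (hF t ht x)
  set g : Icc A B → P := fun t => γ t with hg
  have hgc : Continuous g := continuousOn_iff_continuous_domRestrict.1 hγ
  set W : Icc A B × ℂ → ℂ := fun p => G (g p.1, p.2) with hW
  set E : Icc A B × ℂ → ℂ →L[ℝ] ℂ := fun p =>
    (fderiv ℝ G (g p.1, p.2)).comp (ContinuousLinearMap.inr ℝ P ℂ) with hE
  have hpc : Continuous fun p : Icc A B × ℂ => (g p.1, p.2) := by fun_prop
  have hWc : Continuous W := continuous_iff_continuousAt.2 fun p =>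
    ContinuousAt.comp (g := G) (hGd p.1 p.1.2 p.2).continuousAt hpc.continuousAt
  have hEc : Continuous E := by
    refine Continuous.clm_comp (continuous_iff_continuousAt.2 fun p => ?_) continuous_const
    exact ContinuousAt.comp (g := fderiv ℝ G)
      ((hGd p.1 p.1.2 p.2).continuousAt_fderiv one_ne_zero) hpc.continuousAt
  have hderiv : ∀ p : Icc A B × ℂ, HasFDerivAt (fun x => W (p.1, x)) (E p) p.2 := fun p =>
    HasFDerivAt.comp (g := G) (f := fun x => (g p.1, x)) p.2
      ((hGd p.1 p.1.2 p.2).differentiableAt one_ne_zero).hasFDerivAt (hasFDerivAt_prodMk_right _ _)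
  have hW0 : ∀ (t : Icc A B) (x : ℂ), ρ + 1 ≤ ‖x‖ → W (t, x) = 0 := by
    intro t x hx
    have : b x = 0 := b.zero_of_le_dist (by simpa using hx)
    simp [hW, hG, this]
  have hWs : HasCompactSupport W := by
    refine HasCompactSupport.intro (K := univ ×ˢ closedBall 0 (ρ + 1))
      (isCompact_univ.prod (isCompact_closedBall _ _)) fun p hp => hW0 p.1 p.2 ?_
    simp only [mem_prod, mem_univ, true_and, mem_closedBall_zero_iff, not_le] at hp
    exact hp.le
  have hEs : HasCompactSupport E := by
    refine HasCompactSupport.intro (K := univ ×ˢ closedBall 0 (ρ + 1))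
      (isCompact_univ.prod (isCompact_closedBall _ _)) fun p hp => ?_
    simp only [mem_prod, mem_univ, true_and, mem_closedBall_zero_iff, not_le] at hp
    have h1 : (fun x => W (p.1, x)) =ᶠ[𝓝 p.2] fun _ => 0 := by
      filter_upwards [continuous_norm.continuousAt.eventually (lt_mem_nhds hp)] with x hx
      exact hW0 p.1 x hx.le
    exact (hderiv p).unique ((hasFDerivAt_const _ _).congr_of_eventuallyEq h1)
  obtain ⟨C₁, hC₁⟩ := hWs.exists_bound_of_continuous hWc
  obtain ⟨C₂, hC₂⟩ := hEs.exists_bound_of_continuous hEc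
  have hEu := hEs.uniformContinuous_of_continuous hEc
  have hproj : Continuous fun p : ℝ × ℂ => (projIcc A B hAB p.1, p.2) :=
    (continuous_projIcc.comp continuous_fst).prodMk continuous_snd
  refine ⟨fun t x => W (projIcc A B hAB t, x), fun t x => E (projIcc A B hAB t, x),
    (max C₁ C₂).toNNReal, ⟨fun x => ?_, fun t x => ?_, fun t x => hderiv (_, x), fun t x => ?_,
    hEc.comp hproj, fun ε hε => ?_⟩, fun t ht x hx => ?_⟩
  · exact hWc.comp (continuous_projIcc.prodMk continuous_const)
  · exact ((hC₁ _).trans (le_max_left _ _)).trans (Real.le_coe_toNNReal _)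
  · exact ((hC₂ _).trans (le_max_right _ _)).trans (Real.le_coe_toNNReal _)
  · obtain ⟨δ, hδ, H⟩ := Metric.uniformContinuous_iff.1 hEu ε hε
    refine ⟨δ, hδ, fun t x y hxy => ?_⟩
    rw [← dist_eq_norm]
    exact (H (by simpa [Prod.dist_eq, hδ] using hxy)).le
  · have : b x = 1 := b.one_of_mem_closedBall (by simpa using hx)
    simp [hW, hG, hg, this, projIcc_of_mem hAB ht]

/-- An evolution of separated disks together with a velocity field that realizes it. -/
structure IsCavityFlow {n : ℕ} (R₀ lam κ : ℝ) (z : ℝ → Fin n → ℂ) (m : ℝ → Fin n → ℝ)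
    (τ : ℝ → Fin n → ℂ) (q : ℝ → Fin n → ℝ) (V : ℝ → ℂ → ℂ) (D : ℝ → ℂ → ℂ →L[ℝ] ℂ)
    (K : ℝ≥0) : Prop where
  R₀_pos : 0 < R₀
  one_lt : 1 < lam
  κ_pos : 0 < κ
  κ_lt : κ < 1 / 4
  m_one : ∀ i, m 1 i = 0
  sep : ∀ t ∈ Icc 1 lam, DisksSeparated κ (z t) (m t) ((t * R₀) ^ 2)
  hasDeriv_z : ∀ i, ∀ t ∈ Icc 1 lam, HasDerivWithinAt (fun t => z t i) (τ t i) (Icc 1 lam) t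
  hasDeriv_m : ∀ i, ∀ t ∈ Icc 1 lam, HasDerivWithinAt (fun t => m t i) (2 * q t i) (Icc 1 lam) t
  sum_q : ∀ t ∈ Icc 1 lam, ∑ i, q t i = t * R₀ ^ 2
  field : IsUniformC1Field V D K
  field_eq : ∀ t ∈ Icc 1 lam, ∀ x, ‖x‖ ≤ lam * R₀ + 1 →
    V t x = cavityField κ (z t) (m t) (τ t) (q t) ((t * R₀) ^ 2) x

theorem IsCircEvolution.exists_isCavityFlow {n : ℕ} {R₀ lam : ℝ} {a : Fin n → ℂ}
    {v : Fin n → ℝ} {z : Fin n → ℝ → ℂ} {L : Fin n → ℝ → ℝ} (hR₀ : 0 < R₀) (hlam : 1 < lam)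
    (h : IsCircEvolution n R₀ lam a v z L) :
    ∃ κ τ q V D K, IsCavityFlow R₀ lam κ (fun t i => z i t) (fun t i => L i t ^ 2) τ q V D K := by
  obtain ⟨κ, hκ, hκ4, hsep⟩ := h.exists_separated hR₀
  obtain ⟨hz, hL, hs, hm, -, hL1, -, -, -⟩ := h
  have hud := uniqueDiffOn_Icc hlam
  set τ : ℝ → Fin n → ℂ := fun t i => derivWithin (z i) (Icc 1 lam) t with hτ
  set q : ℝ → Fin n → ℝ := fun t i => derivWithin (fun t => L i t ^ 2) (Icc 1 lam) t / 2 with hq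
  have hdz : ∀ i, ∀ t ∈ Icc 1 lam, HasDerivWithinAt (z i) (τ t i) (Icc 1 lam) t := fun i t ht =>
    ((hz i).differentiableOn one_ne_zero t ht).hasDerivWithinAt
  have hdm : ∀ i, ∀ t ∈ Icc 1 lam,
      HasDerivWithinAt (fun t => L i t ^ 2) (2 * q t i) (Icc 1 lam) t := fun i t ht => by
    rw [hq, mul_div_cancel₀ _ two_ne_zero]
    exact ((hm i).differentiableOn one_ne_zero t ht).hasDerivWithinAt
  have hsum : ∀ t ∈ Icc 1 lam, ∑ i, q t i = t * R₀ ^ 2 := by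
    intro t ht
    have h1 : HasDerivWithinAt (fun t => ∑ i, L i t ^ 2) (∑ i, 2 * q t i) (Icc 1 lam) t :=
      HasDerivWithinAt.fun_sum fun i _ => hdm i t ht
    have h2 : HasDerivWithinAt (fun t : ℝ => (t ^ 2 - 1) * R₀ ^ 2) (2 * t * R₀ ^ 2)
        (Icc 1 lam) t := by
      have := ((((hasDerivAt_id t).pow 2).sub_const 1).mul_const (R₀ ^ 2)).hasDerivWithinAt
        (s := Icc 1 lam)
      simpa using this
    have h3 : EqOn (fun t => ∑ i, L i t ^ 2) (fun t : ℝ => (t ^ 2 - 1) * R₀ ^ 2)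
        (Icc 1 lam) := by
      intro s hs'
      have := hs s hs'
      rw [← Finset.mul_sum] at this
      refine mul_left_cancel₀ Real.pi_ne_zero ?_
      simp only
      linarith
    have h4 := (hud t ht).eq_deriv _ h1 (h2.congr h3 (h3 ht))
    rw [← Finset.mul_sum] at h4
    linarith
  have hP : ContinuousOn (fun t : ℝ => (((fun i => z i t), (fun i => L i t ^ 2), τ t, q t,
      (t * R₀) ^ 2) : CavityParam n)) (Icc 1 lam) := by
    refine ContinuousOn.prodMk (continuousOn_pi.2 fun i => (hz i).continuousOn)
      (ContinuousOn.prodMk (continuousOn_pi.2 fun i => (hm i).continuousOn)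
      (ContinuousOn.prodMk (continuousOn_pi.2 fun i => ?_)
      (ContinuousOn.prodMk (continuousOn_pi.2 fun i => ?_) (by fun_prop))))
    · exact (hz i).continuousOn_derivWithin hud le_rfl
    · exact ((hm i).continuousOn_derivWithin hud le_rfl).div_const 2
  obtain ⟨V, D, K, hV, hVeq⟩ := exists_isUniformC1Field hlam.le hP
    (F := fun r : CavityParam n × ℂ =>
      cavityField κ r.1.1 r.1.2.1 r.1.2.2.1 r.1.2.2.2.1 r.1.2.2.2.2 r.2)
    (fun t ht x => contDiffAt_cavityField hκ _ x (hsep t ht))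
    (show 0 < lam * R₀ + 1 by positivity)
  exact ⟨κ, τ, q, V, D, K, hR₀, hlam, hκ, hκ4, fun i => by simp [hL1 i], hsep, hdz, hdm, hsum,
    hV, hVeq⟩

end Evolution

section Radial

open Complex (normSq I)

/-- The radial area-preserving map opening a disk of squared radius `m` at the origin. -/
noncomputable def radial (m : ℝ) (y : ℂ) : ℂ := Real.sqrt (1 + m / normSq y) • y

variable {m : ℝ} {y : ℂ}

theorem radial_zero_left (y : ℂ) : radial 0 y = y := by simp [radial]

theorem one_add_div_normSq_nonneg (hy : y ≠ 0) (h : 0 ≤ normSq y + m) :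
    0 ≤ 1 + m / normSq y := by
  have hs := Complex.normSq_pos.2 hy
  rw [one_add_div hs.ne']
  exact div_nonneg h hs.le

theorem normSq_radial (hy : y ≠ 0) (h : 0 ≤ normSq y + m) :
    normSq (radial m y) = normSq y + m := by
  have hs := Complex.normSq_pos.2 hy
  rw [radial, Complex.real_smul, map_mul, Complex.normSq_ofReal,
    Real.mul_self_sqrt (one_add_div_normSq_nonneg hy h)]
  field_simp

theorem radial_injOn (hm : 0 ≤ m) : InjOn (radial m) {0}ᶜ := by
  intro y hy y' hy' h
  have e : normSq y = normSq y' := by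
    have h1 := normSq_radial hy (add_nonneg (Complex.normSq_nonneg y) hm)
    have h2 := normSq_radial hy' (add_nonneg (Complex.normSq_nonneg y') hm)
    rw [h] at h1
    linarith
  have hpos : 0 < Real.sqrt (1 + m / normSq y') :=
    Real.sqrt_pos.2 (by have := Complex.normSq_nonneg y'; positivity)
  simp only [radial, e] at h
  exact smul_right_injective ℂ hpos.ne' h

theorem exists_radial_eq {w : ℂ} (hm : 0 ≤ m) (h : m < normSq w) :
    ∃ y, y ≠ 0 ∧ normSq y = normSq w - m ∧ radial m y = w := by
  have hw : 0 < normSq w := hm.trans_lt h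
  have h1 : (normSq w - m) / normSq w = 1 - m / normSq w := by field_simp
  have h0 : 0 < 1 - m / normSq w := h1 ▸ div_pos (sub_pos.2 h) hw
  have hn : normSq (Real.sqrt (1 - m / normSq w) • w) = normSq w - m := by
    rw [Complex.real_smul, map_mul, Complex.normSq_ofReal, Real.mul_self_sqrt h0.le]
    field_simp
  refine ⟨Real.sqrt (1 - m / normSq w) • w, ?_, hn, ?_⟩
  · rw [← Complex.normSq_pos, hn]
    exact sub_pos.2 h
  · rw [radial, hn, smul_smul, ← Real.sqrt_mul' _ h0.le, ← h1]
    have : (1 + m / (normSq w - m)) * ((normSq w - m) / normSq w) = 1 := by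
      have := (sub_pos.2 h).ne'
      field_simp
      ring
    rw [this, Real.sqrt_one, one_smul]

theorem hasDerivWithinAt_radial {μ : ℝ → ℝ} {q t : ℝ} {s : Set ℝ}
    (hμ : HasDerivWithinAt μ (2 * q) s t) (hy : y ≠ 0) (h : 0 < normSq y + μ t) :
    HasDerivWithinAt (fun t => radial (μ t) y)
      ((q / normSq (radial (μ t) y)) • radial (μ t) y) s t := by
  have hs := Complex.normSq_pos.2 hy
  have hpos : 0 < 1 + μ t / normSq y := by
    rw [one_add_div hs.ne']
    exact div_pos h hs
  have h1 := (((hμ.div_const (normSq y)).const_add 1).sqrt hpos.ne').smul_const y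
  refine h1.congr_deriv ?_
  rw [normSq_radial hy h.le, radial, smul_smul]
  congr 1
  have hsq := Real.sq_sqrt hpos.le
  have hg := Real.sqrt_pos.2 hpos
  set g := Real.sqrt (1 + μ t / normSq y)
  have h2 : normSq y + μ t = g ^ 2 * normSq y := by
    rw [hsq]
    field_simp
  rw [h2]
  field_simp

theorem det_complex_clm (Y : ℂ →L[ℝ] ℂ) :
    LinearMap.det Y.toLinearMap = (Y 1).re * (Y I).im - (Y 1).im * (Y I).re := by
  rw [← LinearMap.det_toMatrix Complex.basisOneI, Matrix.det_fin_two]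
  simp [LinearMap.toMatrix_apply]
  ring

theorem exists_hasFDerivAt_radial (hm : 0 ≤ m) (hy : y ≠ 0) :
    ∃ A : ℂ →L[ℝ] ℂ, HasFDerivAt (radial m) A y ∧ LinearMap.det A.toLinearMap = 1 ∧
      ‖A 1‖ ^ 2 + ‖A I‖ ^ 2 ≤ 2 + m / normSq y := by
  have hs := Complex.normSq_pos.2 hy
  have hpos : 0 < 1 + m / normSq y := by positivity
  have hsq := Real.sq_sqrt hpos.le
  have hg := Real.sqrt_pos.2 hpos
  have hre : HasFDerivAt (fun y : ℂ => y.re) Complex.reCLM y := Complex.reCLM.hasFDerivAt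
  have him : HasFDerivAt (fun y : ℂ => y.im) Complex.imCLM y := Complex.imCLM.hasFDerivAt
  have hN : HasFDerivAt (fun y : ℂ => normSq y) ((2 : ℝ) • (y.re • Complex.reCLM +
      y.im • Complex.imCLM)) y := by
    simp only [Complex.normSq_apply]
    refine ((hre.mul hre).add (him.mul him)).congr_fderiv ?_
    ext
    simp
    ring
  have hinv : HasFDerivAt (fun y : ℂ => (normSq y)⁻¹) _ y :=
    (hasDerivAt_inv hs.ne').comp_hasFDerivAt y hN
  have hsqrt : HasFDerivAt (fun y : ℂ => Real.sqrt (1 + m / normSq y)) _ y :=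
    ((hinv.const_mul m).const_add 1).sqrt (by simpa [div_eq_mul_inv] using hpos.ne')
  have hA := HasFDerivAt.fun_smul hsqrt (hasFDerivAt_id y)
  set g := Real.sqrt (1 + m / normSq y) with hgdef
  set c := m / (normSq y ^ 2 * g) with hc
  set A : ℂ →L[ℝ] ℂ := g • ContinuousLinearMap.id ℝ ℂ +
    ((-c) • (y.re • Complex.reCLM + y.im • Complex.imCLM)).smulRight y with hAdef
  have hcg : c * g * normSq y = m / normSq y := by
    rw [hc]
    field_simp
  have hA1 : A 1 = g - c * y.re * y := by
    simp [hAdef, sub_eq_add_neg]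
  have hAI : A I = g * I - c * y.im * y := by
    simp [hAdef, sub_eq_add_neg]
  have hs' := Complex.normSq_apply y
  refine ⟨A, hA.congr_fderiv ?_, ?_, ?_⟩
  · have hL : (1 / (2 * √(1 + m * (normSq y)⁻¹))) • m • (-(normSq y ^ 2)⁻¹) •
        (2 : ℝ) • (y.re • Complex.reCLM + y.im • Complex.imCLM) =
        (-c) • (y.re • Complex.reCLM + y.im • Complex.imCLM) := by
      rw [smul_smul, smul_smul, smul_smul]
      congr 1
      rw [← div_eq_mul_inv m, ← hgdef, hc]
      field_simp
    rw [hAdef, ← hL]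
    rfl
  · rw [det_complex_clm, hA1, hAI]
    simp
    have : g ^ 2 - c * g * normSq y = 1 := by rw [hcg, hsq]; ring
    rw [hs'] at this
    linear_combination this
  · rw [hA1, hAI, ← Complex.normSq_eq_norm_sq, ← Complex.normSq_eq_norm_sq,
      Complex.normSq_apply, Complex.normSq_apply]
    simp
    set r := m / normSq y
    have hr : 0 ≤ r := by positivity
    have h1 : (c * normSq y) ^ 2 ≤ r := by
      have : (c * normSq y) ^ 2 * (1 + r) = r ^ 2 := by
        rw [← hsq, ← hcg]
        ring
      nlinarith
    rw [hs'] at h1 hcg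
    nlinarith

end Radial

section CavityMap

open Complex (normSq I)

namespace IsCavityFlow

variable {n : ℕ} {R₀ lam κ : ℝ} {z : ℝ → Fin n → ℂ} {m : ℝ → Fin n → ℝ} {τ : ℝ → Fin n → ℂ}
  {q : ℝ → Fin n → ℝ} {V : ℝ → ℂ → ℂ} {D : ℝ → ℂ → ℂ →L[ℝ] ℂ} {K : ℝ≥0}

theorem one_mem (h : IsCavityFlow R₀ lam κ z m τ q V D K) : (1 : ℝ) ∈ Icc 1 lam :=
  left_mem_Icc.2 h.one_lt.le

theorem lam_mem (h : IsCavityFlow R₀ lam κ z m τ q V D K) : lam ∈ Icc 1 lam :=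
  right_mem_Icc.2 h.one_lt.le

theorem norm_le_of_normSq_le (h : IsCavityFlow R₀ lam κ z m τ q V D K) {t : ℝ}
    (ht : t ∈ Icc 1 lam) {x : ℂ} (hx : normSq x ≤ (t * R₀) ^ 2) : ‖x‖ ≤ lam * R₀ := by
  rw [Complex.normSq_eq_norm_sq] at hx
  have ht0 : 0 ≤ t * R₀ := mul_nonneg (by linarith [ht.1]) h.R₀_pos.le
  exact (pow_le_pow_iff_left₀ (norm_nonneg x) ht0 two_ne_zero |>.1 hx).trans
    (mul_le_mul_of_nonneg_right ht.2 h.R₀_pos.le)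

theorem six_mul_le (h : IsCavityFlow R₀ lam κ z m τ q V D K) : 6 * κ ≤ R₀ ^ 2 := by
  by_contra! hlt
  exact ((h.sep 1 h.one_mem).outer 0 (by simpa using hlt)).1 rfl

theorem field_eq_inner (h : IsCavityFlow R₀ lam κ z m τ q V D K) {t : ℝ} (ht : t ∈ Icc 1 lam)
    {i : Fin n} {x : ℂ} (hx : κ ≤ normSq (x - z t i) - m t i)
    (hx' : normSq (x - z t i) - m t i < 4 * κ) :
    V t x = τ t i + (q t i / normSq (x - z t i)) • (x - z t i) := by
  have h1 := (h.sep t ht).far_outer i x (by linarith [h.κ_pos])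
  have h2 := h.norm_le_of_normSq_le ht (x := x) (by linarith [h.κ_pos])
  rw [h.field_eq t ht x (by linarith), (h.sep t ht).cavityField_inner h.κ_pos _ _ hx hx']

theorem field_eq_outer (h : IsCavityFlow R₀ lam κ z m τ q V D K) {t : ℝ} (ht : t ∈ Icc 1 lam)
    {x : ℂ} (hx : normSq x ≤ (t * R₀) ^ 2) (hx' : (t * R₀) ^ 2 - normSq x < 4 * κ) :
    V t x = (t * R₀ ^ 2 / normSq x) • x := by
  have h2 := h.norm_le_of_normSq_le ht hx
  rw [h.field_eq t ht x (by linarith), (h.sep t ht).cavityField_outer h.κ_pos _ _ hx',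
    h.sum_q t ht]

theorem trace_eq_zero (h : IsCavityFlow R₀ lam κ z m τ q V D K) {t : ℝ} (ht : t ∈ Icc 1 lam)
    {x : ℂ} (hx : ∀ i, κ < normSq (x - z t i) - m t i) (hx' : normSq x ≤ (t * R₀) ^ 2) :
    (D t x 1).re + (D t x I).im = 0 := by
  obtain ⟨D', hD', h0⟩ := (h.sep t ht).isDivFreeAt h.κ_pos (τ t) (q t) hx
  have h2 := h.norm_le_of_normSq_le ht hx'
  have h3 : V t =ᶠ[𝓝 x] cavityField κ (z t) (m t) (τ t) (q t) ((t * R₀) ^ 2) := by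
    filter_upwards [continuous_norm.continuousAt.eventually
      (gt_mem_nhds (show ‖x‖ < lam * R₀ + 1 by linarith))] with w hw
    exact h.field_eq t ht w hw.le
  rwa [(h.field.hasFDerivAt t x).unique (hD'.congr_of_eventuallyEq h3)]

theorem curve_eq_inner (h : IsCavityFlow R₀ lam κ z m τ q V D K) {X : ℝ → ℂ}
    (hX : IsIntegralCurveOn X V (Icc 1 lam)) {t₀ : ℝ} (ht₀ : t₀ ∈ Icc 1 lam) {i : Fin n}
    (h1 : κ ≤ normSq (X t₀ - z t₀ i) - m t₀ i) (h2 : normSq (X t₀ - z t₀ i) - m t₀ i < 4 * κ) :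
    ∃ y, y ≠ 0 ∧ normSq y = normSq (X t₀ - z t₀ i) - m t₀ i ∧
      ∀ t ∈ Icc 1 lam, X t = z t i + radial (m t i) y := by
  have hκ := h.κ_pos
  obtain ⟨y, hy, hyn, hyr⟩ := exists_radial_eq ((h.sep t₀ ht₀).nonneg i)
    (w := X t₀ - z t₀ i) (by linarith)
  refine ⟨y, hy, hyn, hX.eqOn_Icc (fun t _ => h.field.lipschitz t)
    (Y := fun t => z t i + radial (m t i) y) ?_ ht₀ (by simp [hyr])⟩
  intro t ht
  have hm := (h.sep t ht).nonneg i
  have hr := normSq_radial hy (m := m t i) (by linarith)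
  have hY : normSq (z t i + radial (m t i) y - z t i) - m t i = normSq y := by
    rw [add_sub_cancel_left, hr]
    ring
  rw [h.field_eq_inner ht (by rw [hY]; linarith) (by rw [hY]; linarith), add_sub_cancel_left]
  exact (h.hasDeriv_z i t ht).add (hasDerivWithinAt_radial (h.hasDeriv_m i t ht) hy (by linarith))

theorem curve_eq_outer (h : IsCavityFlow R₀ lam κ z m τ q V D K) {X : ℝ → ℂ}
    (hX : IsIntegralCurveOn X V (Icc 1 lam)) {t₀ : ℝ} (ht₀ : t₀ ∈ Icc 1 lam)
    (h1 : normSq (X t₀) ≤ (t₀ * R₀) ^ 2) (h2 : (t₀ * R₀) ^ 2 - normSq (X t₀) < 4 * κ) :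
    ∃ y, y ≠ 0 ∧ R₀ ^ 2 - normSq y = (t₀ * R₀) ^ 2 - normSq (X t₀) ∧
      ∀ t ∈ Icc 1 lam, X t = radial ((t ^ 2 - 1) * R₀ ^ 2) y := by
  have hκ := h.κ_pos
  have h6 := h.six_mul_le
  have hm : ∀ t ∈ Icc 1 lam, 0 ≤ (t ^ 2 - 1) * R₀ ^ 2 := fun t ht =>
    mul_nonneg (by nlinarith [ht.1]) (sq_nonneg _)
  obtain ⟨y, hy, hyn, hyr⟩ := exists_radial_eq (hm t₀ ht₀) (w := X t₀) (by linarith)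
  refine ⟨y, hy, by linarith, hX.eqOn_Icc (fun t _ => h.field.lipschitz t)
    (Y := fun t => radial ((t ^ 2 - 1) * R₀ ^ 2) y) ?_ ht₀ (by simp [hyr])⟩
  intro t ht
  have hpos := Complex.normSq_pos.2 hy
  have hm' := hm t ht
  have hr := normSq_radial hy (m := (t ^ 2 - 1) * R₀ ^ 2) (by linarith)
  rw [h.field_eq_outer ht (by rw [hr]; linarith) (by rw [hr]; linarith)]
  refine hasDerivWithinAt_radial ?_ hy (by linarith)
  have := ((((hasDerivAt_id t).pow 2).sub_const 1).mul_const (R₀ ^ 2)).hasDerivWithinAt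
    (s := Icc 1 lam)
  simpa [mul_assoc] using this

theorem core_invariant (h : IsCavityFlow R₀ lam κ z m τ q V D K) {X : ℝ → ℂ}
    (hX : IsIntegralCurveOn X V (Icc 1 lam)) {t₀ t : ℝ} (ht₀ : t₀ ∈ Icc 1 lam)
    (ht : t ∈ Icc 1 lam) (h1 : ∀ i, 2 * κ ≤ normSq (X t₀ - z t₀ i) - m t₀ i)
    (h2 : normSq (X t₀) ≤ (t₀ * R₀) ^ 2) :
    (∀ i, 2 * κ ≤ normSq (X t - z t i) - m t i) ∧ normSq (X t) ≤ (t * R₀) ^ 2 := by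
  have hκ := h.κ_pos
  have hXc : ContinuousOn X (Icc 1 lam) := hX.continuousOn
  constructor
  · intro i
    by_contra! hlt
    have hc : ContinuousOn (fun t => normSq (X t - z t i) - m t i) (Icc 1 lam) :=
      (Complex.continuous_normSq.comp_continuousOn (hXc.sub fun t ht =>
        (h.hasDeriv_z i t ht).continuousWithinAt)).sub fun t ht =>
        (h.hasDeriv_m i t ht).continuousWithinAt
    obtain ⟨s, hs, hsw⟩ := isPreconnected_Icc.intermediate_value ht ht₀ hc
      (show max (normSq (X t - z t i) - m t i) κ ∈ _ from
        ⟨le_max_left _ _, max_le (hlt.le.trans (h1 i)) (by linarith [h1 i])⟩)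
    simp only at hsw
    have hw : max (normSq (X t - z t i) - m t i) κ < 2 * κ := max_lt hlt (by linarith)
    obtain ⟨y, hy, hyn, hyX⟩ :=
      h.curve_eq_inner hX hs (i := i) (by rw [hsw]; exact le_max_right _ _)
      (by rw [hsw]; linarith)
    have hm := (h.sep t₀ ht₀).nonneg i
    have := h1 i
    rw [hyX t₀ ht₀, add_sub_cancel_left,
      normSq_radial hy (add_nonneg (Complex.normSq_nonneg y) hm)] at this
    linarith
  · by_contra! hlt
    have hc : ContinuousOn (fun t => (t * R₀) ^ 2 - normSq (X t)) (Icc 1 lam) :=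
      (by fun_prop : ContinuousOn (fun t : ℝ => (t * R₀) ^ 2) (Icc 1 lam)).sub
        (Complex.continuous_normSq.comp_continuousOn hXc)
    obtain ⟨s, hs, hsw⟩ := isPreconnected_Icc.intermediate_value ht ht₀ hc
      (show (0 : ℝ) ∈ _ from ⟨by linarith, by linarith⟩)
    simp only at hsw
    obtain ⟨y, hy, hyn, hyX⟩ := h.curve_eq_outer hX hs (by linarith) (by linarith)
    rw [hyX t ht, normSq_radial hy (add_nonneg (Complex.normSq_nonneg y)
      (mul_nonneg (by nlinarith [ht.1]) (sq_nonneg _)))] at hlt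
    linarith

theorem eq_of_near (h : IsCavityFlow R₀ lam κ z m τ q V D K) {t : ℝ} (ht : t ∈ Icc 1 lam)
    {i j : Fin n} {x : ℂ} (hi : normSq (x - z t i) - m t i < 6 * κ)
    (hj : normSq (x - z t j) - m t j < 6 * κ) : i = j := by
  by_contra hne
  exact absurd ((h.sep t ht).far i j (Ne.symm hne) x hi) (not_le.2 hj)

theorem exists_flow (h : IsCavityFlow R₀ lam κ z m τ q V D K) :
    ∃ φ : ℂ → ℝ → ℂ, ∀ x, φ x 1 = x ∧ IsIntegralCurveOn (φ x) V (Icc 1 lam) := by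
  choose φ hφ using h.field.exists_solution h.one_mem
  exact ⟨φ, hφ⟩

end IsCavityFlow

open Classical in
/-- The map opening round cavities at the points `a i`, radial near these points and equal to `Φ`
away from them. -/
noncomputable def cavityMap {n : ℕ} (κ : ℝ) (a ζ : Fin n → ℂ) (m : Fin n → ℝ) (Φ : ℂ → ℂ)
    (x : ℂ) : ℂ :=
  if h : ∃ i, normSq (x - a i) < 2 * κ then
    ζ h.choose + radial (m h.choose) (x - a h.choose)
  else Φ x

namespace IsCavityFlow

variable {n : ℕ} {R₀ lam κ : ℝ} {z : ℝ → Fin n → ℂ} {m : ℝ → Fin n → ℝ} {τ : ℝ → Fin n → ℂ}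
  {q : ℝ → Fin n → ℝ} {V : ℝ → ℂ → ℂ} {D : ℝ → ℂ → ℂ →L[ℝ] ℂ} {K : ℝ≥0} {φ : ℂ → ℝ → ℂ} {x : ℂ}

theorem cavityMap_of_far (h : IsCavityFlow R₀ lam κ z m τ q V D K)
    (hφ : ∀ x, φ x 1 = x ∧ IsIntegralCurveOn (φ x) V (Icc 1 lam))
    (hx : ∀ i, κ ≤ normSq (x - z 1 i)) :
    cavityMap κ (z 1) (z lam) (m lam) (fun x => φ x lam) x = φ x lam := by
  unfold cavityMap
  split_ifs with hex
  · set i := hex.choose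
    have hi : normSq (x - z 1 i) < 2 * κ := hex.choose_spec
    have hκ := h.κ_pos
    have hm := h.m_one i
    obtain ⟨y, -, -, hy⟩ := h.curve_eq_inner (hφ x).2 h.one_mem (i := i)
      (by rw [(hφ x).1, hm, sub_zero]; exact hx i) (by rw [(hφ x).1, hm]; linarith)
    have h1 := hy 1 h.one_mem
    rw [(hφ x).1, hm, radial_zero_left] at h1
    rw [hy lam h.lam_mem, h1, add_sub_cancel_left]
  · rfl

theorem cavityMap_of_near (h : IsCavityFlow R₀ lam κ z m τ q V D K)
    (hφ : ∀ x, φ x 1 = x ∧ IsIntegralCurveOn (φ x) V (Icc 1 lam)) {i : Fin n}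
    (hx : normSq (x - z 1 i) < 4 * κ) :
    cavityMap κ (z 1) (z lam) (m lam) (fun x => φ x lam) x =
      z lam i + radial (m lam i) (x - z 1 i) := by
  have hκ := h.κ_pos
  have hm := h.m_one
  by_cases hex : ∃ i, normSq (x - z 1 i) < 2 * κ
  · have hj : normSq (x - z 1 hex.choose) < 2 * κ := hex.choose_spec
    have hij := h.eq_of_near h.one_mem (x := x) (i := i) (j := hex.choose)
      (by rw [hm]; linarith) (by rw [hm]; linarith)
    rw [cavityMap, dif_pos hex, ← hij]
  · push Not at hex
    rw [h.cavityMap_of_far hφ fun i => by linarith [hex i]]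
    obtain ⟨y, -, -, hy⟩ := h.curve_eq_inner (hφ x).2 h.one_mem (i := i)
      (by rw [(hφ x).1, hm]; linarith [hex i]) (by rw [(hφ x).1, hm]; linarith)
    have h1 := hy 1 h.one_mem
    rw [(hφ x).1, hm, radial_zero_left] at h1
    rw [hy lam h.lam_mem, h1, add_sub_cancel_left]

theorem cavityMap_near_gap (h : IsCavityFlow R₀ lam κ z m τ q V D K)
    (hφ : ∀ x, φ x 1 = x ∧ IsIntegralCurveOn (φ x) V (Icc 1 lam)) {i : Fin n}
    (hx : normSq (x - z 1 i) < 4 * κ) (hne : x ≠ z 1 i) :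
    normSq (cavityMap κ (z 1) (z lam) (m lam) (fun x => φ x lam) x - z lam i) - m lam i =
      normSq (x - z 1 i) := by
  rw [h.cavityMap_of_near hφ hx, add_sub_cancel_left, normSq_radial (sub_ne_zero.2 hne)
    (add_nonneg (Complex.normSq_nonneg _) ((h.sep lam h.lam_mem).nonneg i)), add_sub_cancel_right]

theorem cavityMap_core (h : IsCavityFlow R₀ lam κ z m τ q V D K)
    (hφ : ∀ x, φ x 1 = x ∧ IsIntegralCurveOn (φ x) V (Icc 1 lam))
    (hx : ∀ i, 2 * κ ≤ normSq (x - z 1 i)) (hx0 : normSq x ≤ R₀ ^ 2) :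
    (∀ i, 2 * κ ≤ normSq (cavityMap κ (z 1) (z lam) (m lam) (fun x => φ x lam) x - z lam i) -
      m lam i) ∧ normSq (cavityMap κ (z 1) (z lam) (m lam) (fun x => φ x lam) x) ≤
      (lam * R₀) ^ 2 := by
  rw [h.cavityMap_of_far hφ fun i => by linarith [hx i, h.κ_pos]]
  refine h.core_invariant (hφ x).2 h.one_mem h.lam_mem (fun i => ?_) ?_
  · rw [(hφ x).1, h.m_one, sub_zero]
    exact hx i
  · rwa [(hφ x).1, one_mul]

theorem cavityMap_injOn (h : IsCavityFlow R₀ lam κ z m τ q V D K)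
    (hφ : ∀ x, φ x 1 = x ∧ IsIntegralCurveOn (φ x) V (Icc 1 lam)) :
    InjOn (cavityMap κ (z 1) (z lam) (m lam) (fun x => φ x lam))
      (closedBall 0 R₀ \ range (z 1)) := by
  have hκ := h.κ_pos
  have key : ∀ x ∈ closedBall (0 : ℂ) R₀ \ range (z 1), ∀ x' ∈ closedBall (0 : ℂ) R₀ \ range (z 1),
      cavityMap κ (z 1) (z lam) (m lam) (fun x => φ x lam) x =
        cavityMap κ (z 1) (z lam) (m lam) (fun x => φ x lam) x' →
      ∀ i, normSq (x - z 1 i) < 2 * κ → x = x' := by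
    intro x hx x' hx' he i hi
    have hne : ∀ i, x ≠ z 1 i := fun i hi => hx.2 ⟨i, hi.symm⟩
    have hne' : ∀ i, x' ≠ z 1 i := fun i hi => hx'.2 ⟨i, hi.symm⟩
    have h1 := h.cavityMap_near_gap hφ (x := x) (i := i) (by linarith) (hne i)
    by_cases hex : ∃ j, normSq (x' - z 1 j) < 2 * κ
    · obtain ⟨j, hj⟩ := hex
      have h2 := h.cavityMap_near_gap hφ (x := x') (i := j) (by linarith) (hne' j)
      rw [← he] at h2
      obtain rfl := h.eq_of_near h.lam_mem (i := i) (j := j)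
        (by rw [h1]; linarith) (by rw [h2]; linarith)
      rw [h.cavityMap_of_near hφ (i := i) (by linarith),
        h.cavityMap_of_near hφ (i := i) (by linarith)] at he
      have := radial_injOn ((h.sep lam h.lam_mem).nonneg i) (sub_ne_zero.2 (hne i))
        (sub_ne_zero.2 (hne' i)) (add_left_cancel he)
      exact sub_left_injective this
    · push Not at hex
      have h2 := (h.cavityMap_core hφ hex (by
        rw [Complex.normSq_eq_norm_sq]
        exact pow_le_pow_left₀ (norm_nonneg _) (by simpa using hx'.1) 2)).1 i
      rw [← he, h1] at h2
      linarith
  intro x hx x' hx' he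
  by_cases hex : ∃ i, normSq (x - z 1 i) < 2 * κ
  · exact hex.elim (key x hx x' hx' he)
  by_cases hex' : ∃ i, normSq (x' - z 1 i) < 2 * κ
  · exact (hex'.elim (key x' hx' x hx he.symm)).symm
  push Not at hex hex'
  rw [h.cavityMap_of_far hφ fun i => by linarith [hex i],
    h.cavityMap_of_far hφ fun i => by linarith [hex' i]] at he
  have := (hφ x).2.eqOn_Icc (fun t _ => h.field.lipschitz t) (hφ x').2 h.lam_mem he h.one_mem
  rwa [(hφ x).1, (hφ x').1] at this

theorem cavityMap_gap (h : IsCavityFlow R₀ lam κ z m τ q V D K)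
    (hφ : ∀ x, φ x 1 = x ∧ IsIntegralCurveOn (φ x) V (Icc 1 lam)) {s : ℝ} (hs0 : 0 < s)
    (hs : s ≤ 2 * κ) (hx : ∀ i, s ≤ normSq (x - z 1 i)) (hx0 : normSq x ≤ R₀ ^ 2) :
    (∀ i, s ≤ normSq (cavityMap κ (z 1) (z lam) (m lam) (fun x => φ x lam) x - z lam i) -
      m lam i) ∧ normSq (cavityMap κ (z 1) (z lam) (m lam) (fun x => φ x lam) x) ≤
      (lam * R₀) ^ 2 := by
  have hκ := h.κ_pos
  by_cases hex : ∃ i, normSq (x - z 1 i) < 2 * κ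
  · obtain ⟨i, hi⟩ := hex
    have hne : x ≠ z 1 i := by
      rintro rfl
      have := hx i
      rw [sub_self, map_zero] at this
      linarith
    have h1 := h.cavityMap_near_gap hφ (x := x) (i := i) (by linarith) hne
    have h6 : normSq (cavityMap κ (z 1) (z lam) (m lam) (fun x => φ x lam) x - z lam i) - m lam i <
      6 * κ := by linarith
    refine ⟨fun j => ?_, ?_⟩
    · rcases eq_or_ne j i with rfl | hj
      · rw [h1]
        exact hx j
      · linarith [(h.sep lam h.lam_mem).far i j hj _ h6]
    · linarith [(h.sep lam h.lam_mem).far_outer i _ h6]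
  · push Not at hex
    obtain ⟨h1, h2⟩ := h.cavityMap_core hφ hex hx0
    exact ⟨fun i => hs.trans (h1 i), h2⟩

theorem exists_cavityMap_eq (h : IsCavityFlow R₀ lam κ z m τ q V D K)
    (hφ : ∀ x, φ x 1 = x ∧ IsIntegralCurveOn (φ x) V (Icc 1 lam)) {s : ℝ} (hs0 : 0 < s)
    (hs : s ≤ 2 * κ) {w : ℂ} (hw : ∀ i, s ≤ normSq (w - z lam i) - m lam i)
    (hw0 : normSq w ≤ (lam * R₀) ^ 2) :
    ∃ x, (∀ i, s ≤ normSq (x - z 1 i)) ∧ normSq x ≤ R₀ ^ 2 ∧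
      cavityMap κ (z 1) (z lam) (m lam) (fun x => φ x lam) x = w := by
  have hκ := h.κ_pos
  by_cases hex : ∃ i, normSq (w - z lam i) - m lam i < 2 * κ
  · obtain ⟨i, hi⟩ := hex
    obtain ⟨y, hy, hyn, hyw⟩ := exists_radial_eq ((h.sep lam h.lam_mem).nonneg i)
      (w := w - z lam i) (by linarith [hw i])
    have h1 : normSq (z 1 i + y - z 1 i) = normSq y := by rw [add_sub_cancel_left]
    have h6 : normSq (z 1 i + y - z 1 i) - m 1 i < 6 * κ := by
      rw [h1, h.m_one]
      linarith
    refine ⟨z 1 i + y, fun j => ?_, ?_, ?_⟩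
    · rcases eq_or_ne j i with rfl | hj
      · rw [h1, hyn]
        exact hw j
      · have := (h.sep 1 h.one_mem).far i j hj _ h6
        rw [h.m_one] at this
        linarith
    · have := (h.sep 1 h.one_mem).far_outer i _ h6
      rw [one_mul] at this
      linarith
    · rw [h.cavityMap_of_near hφ (i := i) (by linarith), add_sub_cancel_left, hyw,
        add_sub_cancel]
  · push Not at hex
    obtain ⟨X, hXw, hX⟩ := h.field.exists_solution h.lam_mem w
    obtain ⟨h1, h2⟩ := h.core_invariant hX h.lam_mem h.one_mem (by rwa [hXw]) (by rwa [hXw])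
    simp only [h.m_one, sub_zero] at h1
    refine ⟨X 1, fun i => hs.trans (h1 i), by simpa using h2, ?_⟩
    rw [h.cavityMap_of_far hφ fun i => by linarith [h1 i], ← hXw]
    exact (hφ (X 1)).2.eqOn_Icc (fun t _ => h.field.lipschitz t) hX h.one_mem (hφ (X 1)).1
      h.lam_mem

theorem cavityMap_sphere (h : IsCavityFlow R₀ lam κ z m τ q V D K)
    (hφ : ∀ x, φ x 1 = x ∧ IsIntegralCurveOn (φ x) V (Icc 1 lam)) (hx : normSq x = R₀ ^ 2) :
    cavityMap κ (z 1) (z lam) (m lam) (fun x => φ x lam) x = lam • x := by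
  have hκ := h.κ_pos
  have h1 := (h.sep 1 h.one_mem).far_of_outer (x := x) (by rw [one_mul, hx]; linarith)
  simp only [h.m_one, sub_zero] at h1
  rw [h.cavityMap_of_far hφ fun i => by linarith [h1 i]]
  obtain ⟨y, -, -, hy⟩ := h.curve_eq_outer (hφ x).2 h.one_mem (by rw [(hφ x).1, one_mul, hx])
    (by rw [(hφ x).1, one_mul, hx]; linarith)
  have h2 := hy 1 h.one_mem
  rw [(hφ x).1, one_pow, sub_self, zero_mul, radial_zero_left] at h2
  have hR := h.R₀_pos.ne'
  rw [hy lam h.lam_mem, ← h2, radial, hx, mul_div_cancel_right₀ _ (pow_ne_zero 2 hR),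
    add_sub_cancel, Real.sqrt_sq (by linarith [h.one_lt])]

theorem exists_hasFDerivAt_cavityMap (h : IsCavityFlow R₀ lam κ z m τ q V D K)
    (hφ : ∀ x, φ x 1 = x ∧ IsIntegralCurveOn (φ x) V (Icc 1 lam)) (hx0 : normSq x ≤ R₀ ^ 2)
    (hx : ∀ i, x ≠ z 1 i) :
    ∃ A : ℂ →L[ℝ] ℂ,
      HasFDerivAt (cavityMap κ (z 1) (z lam) (m lam) (fun x => φ x lam)) A x ∧
      LinearMap.det A.toLinearMap = 1 ∧
      ‖A 1‖ ^ 2 + ‖A I‖ ^ 2 ≤ 2 * Real.exp (K * (lam - 1)) ^ 2 +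
        ∑ i, m lam i * (ball (0 : ℂ) 1).indicator (fun y => (‖y‖ ^ 2)⁻¹) (x - z 1 i) := by
  have hκ := h.κ_pos
  have hm := (h.sep lam h.lam_mem).nonneg
  have hexp : 1 ≤ Real.exp (K * (lam - 1)) :=
    Real.one_le_exp (mul_nonneg K.2 (by linarith [h.one_lt]))
  have hnn : ∀ i, 0 ≤ m lam i *
      (ball (0 : ℂ) 1).indicator (fun y => (‖y‖ ^ 2)⁻¹) (x - z 1 i) := fun i =>
    mul_nonneg (hm i) (indicator_nonneg (fun y _ => by positivity) _)
  have hcont : ∀ i, Continuous fun x : ℂ => normSq (x - z 1 i) := fun i =>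
    Complex.continuous_normSq.comp (continuous_id.sub continuous_const)
  by_cases hex : ∃ i, normSq (x - z 1 i) < 4 * κ
  · obtain ⟨i, hi⟩ := hex
    obtain ⟨A, hA, hdet, hfrob⟩ := exists_hasFDerivAt_radial (hm i) (sub_ne_zero.2 (hx i))
    refine ⟨A, ?_, hdet, ?_⟩
    · have h1 : HasFDerivAt (fun x => z lam i + radial (m lam i) (x - z 1 i)) A x := by
        have := HasFDerivAt.comp x hA ((hasFDerivAt_id x).sub_const (z 1 i))
        exact this.const_add _
      refine h1.congr_of_eventuallyEq ?_
      filter_upwards [(hcont i).continuousAt.eventually (gt_mem_nhds hi)] with w hw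
      exact h.cavityMap_of_near hφ hw
    · have h1 : x - z 1 i ∈ ball (0 : ℂ) 1 := by
        rw [mem_ball_zero_iff]
        rw [Complex.normSq_eq_norm_sq] at hi
        have := h.κ_lt
        nlinarith [norm_nonneg (x - z 1 i)]
      have h2 := Finset.single_le_sum (fun i _ => hnn i) (Finset.mem_univ i)
      rw [indicator_of_mem h1, ← Complex.normSq_eq_norm_sq, ← div_eq_mul_inv] at h2
      nlinarith
  · push Not at hex
    obtain ⟨Y, hY, hYn, hYdet⟩ := h.field.exists_hasFDerivAt_flow h.one_lt.le
      (fun x => (hφ x).1) (fun x => (hφ x).2) x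
    refine ⟨Y, ?_, hYdet fun t ht => ?_, ?_⟩
    · refine hY.congr_of_eventuallyEq ?_
      have : ∀ᶠ w in 𝓝 x, ∀ i, κ < normSq (w - z 1 i) := by
        rw [eventually_all]
        exact fun i => (hcont i).continuousAt.eventually (lt_mem_nhds (by linarith [hex i]))
      filter_upwards [this] with w hw
      exact h.cavityMap_of_far hφ fun i => (hw i).le
    · obtain ⟨h1, h2⟩ := h.core_invariant (hφ x).2 h.one_mem ht
        (fun i => by rw [(hφ x).1, h.m_one]; linarith [hex i]) (by rwa [(hφ x).1, one_mul])
      exact h.trace_eq_zero ht (fun i => by linarith [h1 i]) h2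
    · have h1 := hYn 1
      have h2 := hYn I
      rw [norm_one, mul_one] at h1
      rw [Complex.norm_I, mul_one] at h2
      have h3 := Finset.sum_nonneg fun i (_ : i ∈ Finset.univ) => hnn i
      have h4 := pow_le_pow_left₀ (norm_nonneg _) h1 2
      have h5 := pow_le_pow_left₀ (norm_nonneg _) h2 2
      linarith

end IsCavityFlow

end CavityMap

section SingularEnergy

open MeasureTheory

/-- On `ℂ` the function `‖y‖⁻²`, truncated to the annulus `ε < ‖y‖ < 1`, is integrable. -/
theorem integrable_annulus_inv_sq {ε : ℝ} (hε : 0 < ε) :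
    Integrable fun y : ℂ => (Ioo ε 1).indicator (fun r : ℝ => (r ^ 2)⁻¹) ‖y‖ := by
  rw [integrable_fun_norm_addHaar volume (f := (Ioo ε 1).indicator fun r : ℝ => (r ^ 2)⁻¹)]
  have h1 : (fun y : ℝ => y ^ (Module.finrank ℝ ℂ - 1) •
      (Ioo ε 1).indicator (fun r : ℝ => (r ^ 2)⁻¹) y) =
      (Ioo ε 1).indicator fun r => r * (r ^ 2)⁻¹ := by
    ext y
    by_cases hy : y ∈ Ioo ε 1 <;> simp [hy, Complex.finrank_real_complex]
  rw [h1]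
  refine Integrable.integrableOn ((integrable_indicator_iff measurableSet_Ioo).2 ?_)
  refine (ContinuousOn.integrableOn_Icc ?_).mono_set Ioo_subset_Icc_self
  exact continuousOn_id.mul ((continuousOn_id.pow 2).inv₀ fun x hx =>
    (pow_pos (hε.trans_le hx.1) 2).ne')

theorem integral_annulus_inv_sq {ε : ℝ} (hε : 0 < ε) (hε1 : ε ≤ 1) :
    ∫ y : ℂ, (Ioo ε 1).indicator (fun r : ℝ => (r ^ 2)⁻¹) ‖y‖ = 2 * Real.pi * |Real.log ε| := by
  rw [integral_fun_norm_addHaar volume ((Ioo ε 1).indicator fun r : ℝ => (r ^ 2)⁻¹)]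
  have h1 : (fun y : ℝ => y ^ (Module.finrank ℝ ℂ - 1) •
      (Ioo ε 1).indicator (fun r : ℝ => (r ^ 2)⁻¹) y) =
      (Ioo ε 1).indicator fun r => r⁻¹ := by
    ext y
    by_cases hy : y ∈ Ioo ε 1
    · have : y ≠ 0 := (hε.trans hy.1).ne'
      simp only [Complex.finrank_real_complex, hy, indicator_of_mem, smul_eq_mul]
      field_simp
      simp
    · simp [hy]
  have h2 : volume.real (ball (0 : ℂ) 1) = Real.pi := by
    simp [Measure.real, Complex.volume_ball]
  rw [h1, h2, setIntegral_indicator measurableSet_Ioo,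
    inter_eq_right.2 (Ioo_subset_Ioi_self.trans (Ioi_subset_Ioi hε.le)),
    ← integral_Ioc_eq_integral_Ioo,
    ← intervalIntegral.integral_of_le hε1, integral_inv_of_pos hε one_pos,
    Complex.finrank_real_complex, one_div, Real.log_inv, abs_of_nonpos (Real.log_nonpos hε.le hε1)]
  simp [mul_assoc]

theorem memLp_indicator_ball_inv_norm {p : ℝ} (hp : 1 ≤ p) (hp2 : p < 2) :
    MemLp ((ball (0 : ℂ) 1).indicator fun y => ‖y‖⁻¹) (ENNReal.ofReal p) volume := by
  rw [memLp_indicator_iff_restrict measurableSet_ball]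
  have hm : AEStronglyMeasurable (fun y : ℂ => ‖y‖⁻¹) (volume.restrict (ball 0 1)) :=
    (measurable_norm.inv).aestronglyMeasurable
  rw [← integrable_norm_rpow_iff hm (by simp; linarith) ENNReal.ofReal_ne_top,
    ENNReal.toReal_ofReal (by linarith)]
  have h := (integrableOn_fun_norm_addHaar (E := ℂ) volume (f := fun r : ℝ => ‖r⁻¹‖ ^ p)
    (r := 1)).2 ?_
  · simpa [IntegrableOn] using h
  · have h1 := (intervalIntegral.intervalIntegrable_rpow' (a := 0) (b := 1) (r := 1 - p)
      (by linarith)).1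
    refine (h1.mono_set Ioo_subset_Ioc_self).congr_fun (fun x hx => ?_) measurableSet_Ioo
    have hx0 : 0 < x := hx.1
    simp only [Complex.finrank_real_complex, smul_eq_mul]
    rw [Real.norm_of_nonneg (inv_nonneg.2 hx0.le), Real.inv_rpow hx0.le, Real.rpow_sub hx0]
    norm_num [div_eq_mul_inv]

variable {ι : Type*} [Fintype ι] {a : ι → ℂ} {m : ι → ℝ} {C R ε : ℝ} {f : ℂ → ℝ}

/-- A density with inverse-square poles of strength `m i` at `a i` has at most logarithmically
divergent energy off the `ε`-disks around the poles. -/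
theorem setIntegral_half_le_of_le_singular (hm : ∀ i, 0 ≤ m i) (hC : 0 ≤ C) (hf0 : ∀ x, 0 ≤ f x)
    (hε : 0 < ε) (hε1 : ε ≤ 1)
    (hf : ∀ x ∈ ball (0 : ℂ) R, (∀ i, x ≠ a i) →
      f x ≤ C + ∑ i, m i * (ball (0 : ℂ) 1).indicator (fun y => (‖y‖ ^ 2)⁻¹) (x - a i)) :
    ∫ x in ball (0 : ℂ) R \ ⋃ i, closedBall (a i) ε, f x / 2 ≤
      C / 2 * volume.real (ball (0 : ℂ) R) + (∑ i, Real.pi * m i) * |Real.log ε| := by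
  set S := ball (0 : ℂ) R \ ⋃ i, closedBall (a i) ε with hS
  set g : ℂ → ℝ := fun y => (Ioo ε 1).indicator (fun r : ℝ => (r ^ 2)⁻¹) ‖y‖ with hg
  have hSm : MeasurableSet S :=
    measurableSet_ball.diff (MeasurableSet.iUnion fun i => measurableSet_closedBall)
  have hSfin : volume S ≠ ⊤ := measure_ne_top_of_subset sdiff_subset measure_ball_lt_top.ne
  have hgi : ∀ i, Integrable fun x => m i / 2 * g (x - a i) := fun i =>
    ((integrable_annulus_inv_sq hε).comp_sub_right (a i)).const_mul _
  have hg0 : ∀ y, 0 ≤ g y := fun y => indicator_nonneg (fun r _ => by positivity) _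
  have hconst : IntegrableOn (fun _ : ℂ => C / 2) S := integrableOn_const hSfin
  have hsumi : IntegrableOn (fun x => ∑ i, m i / 2 * g (x - a i)) S :=
    (integrable_finsetSum _ fun i _ => hgi i).integrableOn
  have hle : ∀ x ∈ S, f x / 2 ≤ C / 2 + ∑ i, m i / 2 * g (x - a i) := by
    intro x hx
    have hxε : ∀ i, ε < ‖x - a i‖ := fun i => by
      have hi : x ∉ closedBall (a i) ε := fun hi => hx.2 (mem_iUnion.2 ⟨i, hi⟩)
      rwa [mem_closedBall, not_le, dist_eq_norm] at hi
    have h1 := hf x hx.1 fun i hi => by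
      have := hxε i
      rw [hi, sub_self, norm_zero] at this
      linarith
    have h2 : ∀ i, (ball (0 : ℂ) 1).indicator (fun y => (‖y‖ ^ 2)⁻¹) (x - a i) = g (x - a i) := by
      intro i
      simp [hg, indicator, hxε i]
    simp only [h2] at h1
    have h3 : ∑ i, m i / 2 * g (x - a i) = (∑ i, m i * g (x - a i)) / 2 := by
      rw [Finset.sum_div]
      exact Finset.sum_congr rfl fun i _ => by ring
    rw [h3]
    linarith
  calc ∫ x in S, f x / 2 ≤ ∫ x in S, (C / 2 + ∑ i, m i / 2 * g (x - a i)) :=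
        integral_mono_of_nonneg (Eventually.of_forall fun x => by have := hf0 x; positivity)
          (hconst.add hsumi) ((ae_restrict_iff' hSm).2 (Eventually.of_forall hle))
    _ = volume.real S * (C / 2) + ∫ x in S, ∑ i, m i / 2 * g (x - a i) := by
        rw [integral_add hconst hsumi, setIntegral_const, smul_eq_mul]
    _ ≤ volume.real (ball (0 : ℂ) R) * (C / 2) + ∫ x, ∑ i, m i / 2 * g (x - a i) := by
        refine add_le_add (mul_le_mul_of_nonneg_right
          (measureReal_mono sdiff_subset measure_ball_lt_top.ne) (by positivity)) ?_
        refine setIntegral_le_integral (integrable_finsetSum _ fun i _ => hgi i)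
          (Eventually.of_forall fun x => Finset.sum_nonneg fun i _ => ?_)
        exact mul_nonneg (by linarith [hm i]) (hg0 _)
    _ = _ := by
        rw [integral_finsetSum _ fun i _ => hgi i, Finset.sum_mul, mul_comm]
        congr 1
        refine Finset.sum_congr rfl fun i _ => ?_
        rw [integral_const_mul, integral_sub_right_eq_self g (a i),
          integral_annulus_inv_sq hε hε1]
        ring

/-- A function with inverse-square poles has a square root in `L^p` for `p < 2`. -/
theorem integrableOn_sqrt_rpow_of_le_singular {p : ℝ} (hp : 1 ≤ p) (hp2 : p < 2)
    (hm : ∀ i, 0 ≤ m i) (hC : 0 ≤ C) (hfm : Measurable f)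
    (hf : ∀ x ∈ ball (0 : ℂ) R, (∀ i, x ≠ a i) →
      f x ≤ C + ∑ i, m i * (ball (0 : ℂ) 1).indicator (fun y => (‖y‖ ^ 2)⁻¹) (x - a i)) :
    IntegrableOn (fun x => √(f x) ^ p) (ball (0 : ℂ) R) := by
  set h : ℂ → ℝ := (ball (0 : ℂ) 1).indicator fun y => ‖y‖⁻¹ with hh
  have hh0 : ∀ y, 0 ≤ h y := fun y => indicator_nonneg (fun y _ => by positivity) _
  have hsq : ∀ y, (ball (0 : ℂ) 1).indicator (fun y => (‖y‖ ^ 2)⁻¹) y = h y ^ 2 := by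
    intro y
    by_cases hy : y ∈ ball (0 : ℂ) 1
    · rw [hh, indicator_of_mem hy, indicator_of_mem hy, inv_pow]
    · rw [hh, indicator_of_notMem hy, indicator_of_notMem hy]
      norm_num
  have hG : MemLp (fun x => √C + ∑ i, √(m i) * h (x - a i)) (ENNReal.ofReal p)
      (volume.restrict (ball (0 : ℂ) R)) := by
    refine MemLp.add ?_ (memLp_finsetSum _ fun i _ => ?_)
    · have : IsFiniteMeasure (volume.restrict (ball (0 : ℂ) R)) :=
        isFiniteMeasure_restrict.2 measure_ball_lt_top.ne
      exact memLp_const _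
    · refine MemLp.restrict _ (MemLp.const_mul ?_ _)
      exact (memLp_indicator_ball_inv_norm hp hp2).comp_measurePreserving
        (measurePreserving_sub_right volume (a i))
  have hF : MemLp (fun x => √(f x)) (ENNReal.ofReal p) (volume.restrict (ball (0 : ℂ) R)) := by
    refine hG.of_le hfm.sqrt.aestronglyMeasurable ?_
    have hnull : ∀ᵐ x ∂(volume.restrict (ball (0 : ℂ) R)), ∀ i, x ≠ a i :=
      ae_all_iff.2 fun i => ae_restrict_of_ae (Measure.ae_ne volume (a i))
    filter_upwards [hnull, ae_restrict_mem measurableSet_ball] with x hx hxR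
    have h0 : 0 ≤ ∑ i, √(m i) * h (x - a i) :=
      Finset.sum_nonneg fun i _ => mul_nonneg (Real.sqrt_nonneg _) (hh0 _)
    rw [Real.norm_of_nonneg (Real.sqrt_nonneg _), Real.norm_of_nonneg (by positivity)]
    refine Real.sqrt_le_iff.2 ⟨by positivity, (hf x hxR hx).trans ?_⟩
    have h1 := Finset.sum_sq_le_sq_sum_of_nonneg (s := Finset.univ)
      (f := fun i => √(m i) * h (x - a i)) fun i _ => mul_nonneg (Real.sqrt_nonneg _) (hh0 _)
    have h2 : ∑ i, (√(m i) * h (x - a i)) ^ 2 =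
        ∑ i, m i * (ball (0 : ℂ) 1).indicator (fun y => (‖y‖ ^ 2)⁻¹) (x - a i) :=
      Finset.sum_congr rfl fun i _ => by rw [mul_pow, Real.sq_sqrt (hm i), hsq]
    rw [h2] at h1
    nlinarith [Real.sq_sqrt hC, mul_nonneg (Real.sqrt_nonneg C) h0]
  have := hF.integrable_norm_rpow (by simp; linarith) ENNReal.ofReal_ne_top
  rw [ENNReal.toReal_ofReal (by linarith)] at this
  simpa only [IntegrableOn, Real.norm_of_nonneg (Real.sqrt_nonneg _)] using this

/-- A function with inverse-square poles is locally integrable off the poles. -/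
theorem integrableOn_of_le_singular {s : Set ℂ} (hs : IsCompact s) (hm : ∀ i, 0 ≤ m i)
    (hfm : Measurable f) (hf0 : ∀ x, 0 ≤ f x) (hsa : ∀ x ∈ s, ∀ i, x ≠ a i)
    (hf : ∀ x ∈ s,
      f x ≤ C + ∑ i, m i * (ball (0 : ℂ) 1).indicator (fun y => (‖y‖ ^ 2)⁻¹) (x - a i)) :
    IntegrableOn f s := by
  have hcont : ContinuousOn (fun x => C + ∑ i, m i * (‖x - a i‖ ^ 2)⁻¹) s := by
    refine continuousOn_const.add (continuousOn_finsetSum _ fun i _ => ?_)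
    refine continuousOn_const.mul (ContinuousOn.inv₀ (by fun_prop) fun x hx => ?_)
    exact pow_ne_zero 2 (norm_ne_zero_iff.2 (sub_ne_zero.2 (hsa x hx i)))
  refine (hcont.integrableOn_compact hs).mono' hfm.aestronglyMeasurable ?_
  filter_upwards [ae_restrict_mem hs.measurableSet] with x hx
  rw [Real.norm_of_nonneg (hf0 x)]
  refine (hf x hx).trans ?_
  gcongr with i
  · exact hm i
  · exact indicator_le_self' (fun y _ => by positivity) _

end SingularEnergy

section Deformation

open Complex (normSq I)
open MeasureTheory

namespace IsCavityFlow

variable {n : ℕ} {R₀ lam κ : ℝ} {z : ℝ → Fin n → ℂ} {m : ℝ → Fin n → ℝ} {τ : ℝ → Fin n → ℂ}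
  {q : ℝ → Fin n → ℝ} {V : ℝ → ℂ → ℂ} {D : ℝ → ℂ → ℂ →L[ℝ] ℂ} {K : ℝ≥0} {φ : ℂ → ℝ → ℂ}

theorem norm_cavityMap_le (h : IsCavityFlow R₀ lam κ z m τ q V D K)
    (hφ : ∀ x, φ x 1 = x ∧ IsIntegralCurveOn (φ x) V (Icc 1 lam)) {x : ℂ} (hx0 : ‖x‖ ≤ R₀)
    (hx : ∀ i, x ≠ z 1 i) :
    ‖cavityMap κ (z 1) (z lam) (m lam) (fun x => φ x lam) x‖ ≤ lam * R₀ := by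
  obtain ⟨s, hs, hs0⟩ : ∃ s, (s ≤ 2 * κ ∧ ∀ i, s ≤ normSq (x - z 1 i)) ∧ s ∈ Ioi (0 : ℝ) := by
    have h1 : ∀ᶠ s in 𝓝[>] (0 : ℝ), s ≤ 2 * κ ∧ ∀ i, s ≤ normSq (x - z 1 i) := by
      have h2 : ∀ᶠ s in 𝓝 (0 : ℝ), ∀ i, s ≤ normSq (x - z 1 i) := eventually_all.2 fun i =>
        eventually_le_nhds (Complex.normSq_pos.2 (sub_ne_zero.2 (hx i)))
      exact nhdsWithin_le_nhds
        ((eventually_le_nhds (mul_pos two_pos h.κ_pos)).and h2)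
    exact (h1.and self_mem_nhdsWithin).exists
  have h1 := (h.cavityMap_gap hφ hs0 hs.1 hs.2 (by
    rw [Complex.normSq_eq_norm_sq]; exact pow_le_pow_left₀ (norm_nonneg _) hx0 2)).2
  rw [Complex.normSq_eq_norm_sq] at h1
  exact (sq_le_sq₀ (norm_nonneg _) (mul_nonneg (by linarith [h.one_lt]) h.R₀_pos.le)).1 h1

theorem image_cavityMap (h : IsCavityFlow R₀ lam κ z m τ q V D K)
    (hφ : ∀ x, φ x 1 = x ∧ IsIntegralCurveOn (φ x) V (Icc 1 lam)) {ε : ℝ} (hε : 0 < ε)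
    (hεκ : ε ^ 2 ≤ 2 * κ) :
    cavityMap κ (z 1) (z lam) (m lam) (fun x => φ x lam) ''
        (closedBall 0 R₀ \ ⋃ i, ball (z 1 i) ε) =
      closedBall 0 (lam * R₀) \ ⋃ i, ball (z lam i) √(m lam i + ε ^ 2) := by
  have hR := h.R₀_pos.le
  have hlR : 0 ≤ lam * R₀ := mul_nonneg (by linarith [h.one_lt]) hR
  have hin : ∀ x, x ∈ closedBall (0 : ℂ) R₀ \ ⋃ i, ball (z 1 i) ε ↔
      normSq x ≤ R₀ ^ 2 ∧ ∀ i, ε ^ 2 ≤ normSq (x - z 1 i) := by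
    intro x
    simp only [Set.mem_sdiff, mem_closedBall_zero_iff, mem_iUnion, not_exists, mem_ball, not_lt,
      dist_eq_norm, Complex.normSq_eq_norm_sq, sq_le_sq₀ (norm_nonneg _) hR,
      sq_le_sq₀ hε.le (norm_nonneg _)]
  have hout : ∀ w, w ∈ closedBall (0 : ℂ) (lam * R₀) \ ⋃ i, ball (z lam i) √(m lam i + ε ^ 2) ↔
      normSq w ≤ (lam * R₀) ^ 2 ∧ ∀ i, ε ^ 2 ≤ normSq (w - z lam i) - m lam i := by
    intro w
    simp only [Set.mem_sdiff, mem_closedBall_zero_iff, mem_iUnion, not_exists, mem_ball, not_lt,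
      dist_eq_norm, Complex.normSq_eq_norm_sq, sq_le_sq₀ (norm_nonneg _) hlR,
      Real.sqrt_le_left (norm_nonneg _), le_sub_iff_add_le']
  ext w
  rw [hout, mem_image]
  constructor
  · rintro ⟨x, hx, rfl⟩
    rw [hin] at hx
    exact (h.cavityMap_gap hφ (by positivity) hεκ hx.2 hx.1).symm
  · rintro ⟨hw0, hw⟩
    obtain ⟨x, hx, hx0, hxw⟩ := h.exists_cavityMap_eq hφ (by positivity) hεκ hw hw0
    exact ⟨x, (hin x).2 ⟨hx0, hx⟩, hxw⟩

theorem integrableOn_norm_cavityMap_rpow (h : IsCavityFlow R₀ lam κ z m τ q V D K)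
    (hφ : ∀ x, φ x 1 = x ∧ IsIntegralCurveOn (φ x) V (Icc 1 lam))
    (hd : ContinuousOn (cavityMap κ (z 1) (z lam) (m lam) (fun x => φ x lam))
      (ball 0 R₀ \ range (z 1))) {p : ℝ} (hp : 0 ≤ p) :
    IntegrableOn (fun x => ‖cavityMap κ (z 1) (z lam) (m lam) (fun x => φ x lam) x‖ ^ p)
      (ball 0 R₀) := by
  have hms : MeasurableSet (ball (0 : ℂ) R₀ \ range (z 1)) :=
    measurableSet_ball.diff (finite_range _).measurableSet
  have hae : (ball (0 : ℂ) R₀ \ range (z 1) : Set ℂ) =ᵐ[volume] ball (0 : ℂ) R₀ :=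
    sdiff_null_ae_eq_self ((finite_range _).measure_zero _)
  refine IntegrableOn.congr_set_ae ?_ hae.symm
  have : IsFiniteMeasure (volume.restrict (ball (0 : ℂ) R₀ \ range (z 1))) :=
    isFiniteMeasure_restrict.2 (measure_ne_top_of_subset sdiff_subset measure_ball_lt_top.ne)
  refine Integrable.of_bound (C := (lam * R₀) ^ p) ?_ ?_
  · exact ((hd.norm).rpow_const fun x _ => Or.inr hp).aestronglyMeasurable hms
  · filter_upwards [ae_restrict_mem hms] with x hx
    rw [Real.norm_of_nonneg (by positivity)]
    refine Real.rpow_le_rpow (norm_nonneg _) (h.norm_cavityMap_le hφ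
      (mem_ball_zero_iff.1 hx.1).le fun i hi => hx.2 ⟨i, hi.symm⟩) hp

end IsCavityFlow

end Deformation

end CavityDeformation

theorem stmt_16 (n : ℕ) (R₀ lam : ℝ) (hR₀ : 0 < R₀) (hlam : 1 < lam)
    (a : Fin n → ℂ) (v : Fin n → ℝ) (ha : ∀ i, a i ∈ Metric.ball (0:ℂ) R₀) (hv : ∀ i, 0 < v i)
    (hsum : ∑ i, v i = (lam ^ 2 - 1) * Real.pi * R₀ ^ 2)
    (hatt : ∃ z L, IsCircEvolution n R₀ lam a v z L) :
    ∃ (ζ : Fin n → ℂ) (ε₀ Cst : ℝ) (u : ℂ → ℂ),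
      (∀ i, ζ i ∈ Metric.ball (0:ℂ) (lam * R₀)) ∧
      0 < ε₀ ∧ ε₀ < 1 ∧
      -- `u` is injective on `𝓑̄ ∖ {a₁,…,aₙ}`
      Set.InjOn u (Metric.closedBall (0:ℂ) R₀ \ Set.range a) ∧
      -- (i) `u` is differentiable away from the cavitation points, and lies in
      -- `W^{1,p}(𝓑)` for every `1 ≤ p < 2` and in `H¹_loc(𝓑 ∖ {a₁,…,aₙ})`
      DifferentiableOn ℝ u (Metric.ball (0:ℂ) R₀ \ Set.range a) ∧
      (∀ p : ℝ, 1 ≤ p → p < 2 →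
        MeasureTheory.IntegrableOn (fun x => ‖u x‖ ^ p) (Metric.ball (0:ℂ) R₀) ∧
        MeasureTheory.IntegrableOn
          (fun x => Real.sqrt (‖fderiv ℝ u x 1‖ ^ 2 + ‖fderiv ℝ u x Complex.I‖ ^ 2) ^ p)
          (Metric.ball (0:ℂ) R₀)) ∧
      (∀ s : Set ℂ, IsCompact s → s ⊆ Metric.ball (0:ℂ) R₀ \ Set.range a →
        MeasureTheory.IntegrableOn
          (fun x => ‖fderiv ℝ u x 1‖ ^ 2 + ‖fderiv ℝ u x Complex.I‖ ^ 2) s) ∧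
      -- (ii) boundary condition
      (∀ x ∈ Metric.sphere (0:ℂ) R₀, u x = lam • x) ∧
      -- (iii) incompressibility a.e.
      (∀ᵐ x ∂MeasureTheory.volume, x ∈ Metric.ball (0:ℂ) R₀ →
        DifferentiableAt ℝ u x ∧ LinearMap.det (fderiv ℝ u x).toLinearMap = 1) ∧
      -- (iv) round cavities of the prescribed areas open at the prescribed sites
      (∀ ε : ℝ, 0 < ε → ε ≤ ε₀ →
        u '' (Metric.closedBall (0:ℂ) R₀ \ ⋃ i, Metric.ball (a i) ε) =
          Metric.closedBall (0:ℂ) (lam * R₀) \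
            ⋃ i, Metric.ball (ζ i) (Real.sqrt (v i / Real.pi + ε ^ 2))) ∧
      -- (v) energy upper bound (Frobenius norm of the derivative)
      (∀ ε : ℝ, 0 < ε → ε ≤ ε₀ →
        (∫ x in Metric.ball (0:ℂ) R₀ \ ⋃ i, Metric.closedBall (a i) ε,
          (‖fderiv ℝ u x 1‖ ^ 2 + ‖fderiv ℝ u x Complex.I‖ ^ 2) / 2) ≤
          Cst + (∑ i, v i) * |Real.log ε|) := by
  obtain ⟨z, L, hcirc⟩ := hatt
  obtain ⟨κ, τ, q, V, D, K, h⟩ := hcirc.exists_isCavityFlow hR₀ hlam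
  obtain ⟨φ, hφ⟩ := h.exists_flow
  have hza : ∀ i, z i 1 = a i := hcirc.2.2.2.2.1
  have hLv : ∀ i, Real.pi * L i lam ^ 2 = v i := hcirc.2.2.2.2.2.2.1
  have hL0 : ∀ i, 0 ≤ L i lam := fun i => hcirc.2.1 i lam h.lam_mem
  have hsub : ∀ i, Metric.closedBall (z i lam) (L i lam) ⊆ Metric.ball (0:ℂ) (lam * R₀) :=
    hcirc.2.2.2.2.2.2.2.2 lam h.lam_mem
  have hm : ∀ i, 0 ≤ L i lam ^ 2 := fun i => sq_nonneg _
  obtain rfl : (fun i => z i 1) = a := funext hza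
  set u := cavityMap κ (fun i => z i 1) (fun i => z i lam) (fun i => L i lam ^ 2)
    (fun x => φ x lam) with hu
  set C := 2 * Real.exp (K * (lam - 1)) ^ 2 with hC
  have hC0 : 0 ≤ C := by positivity
  set f : ℂ → ℝ := fun x => ‖fderiv ℝ u x 1‖ ^ 2 + ‖fderiv ℝ u x Complex.I‖ ^ 2 with hf
  have hf0 : ∀ x, 0 ≤ f x := fun x => by positivity
  have hfm : Measurable f :=
    ((measurable_fderiv_apply_const ℝ u 1).norm.pow_const 2).add
      ((measurable_fderiv_apply_const ℝ u Complex.I).norm.pow_const 2)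
  have hderiv : ∀ x ∈ Metric.ball (0:ℂ) R₀, (∀ i, x ≠ z i 1) →
      DifferentiableAt ℝ u x ∧ LinearMap.det (fderiv ℝ u x).toLinearMap = 1 ∧
      f x ≤ C + ∑ i, L i lam ^ 2 *
        (Metric.ball (0:ℂ) 1).indicator (fun y => (‖y‖ ^ 2)⁻¹) (x - z i 1) := by
    intro x hx hxa
    obtain ⟨A, hA, hdet, hle⟩ := h.exists_hasFDerivAt_cavityMap hφ (x := x) (by
      rw [Complex.normSq_eq_norm_sq]
      exact pow_le_pow_left₀ (norm_nonneg _) (mem_ball_zero_iff.1 hx).le 2) hxa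
    have hAu : fderiv ℝ u x = A := hA.fderiv
    refine ⟨hA.differentiableAt, hAu ▸ hdet, ?_⟩
    simp only [hf, hAu]
    exact hle
  have hne : ∀ x : ℂ, x ∉ Set.range (fun i => z i 1) → ∀ i, x ≠ z i 1 :=
    fun x hx i hi => hx ⟨i, hi.symm⟩
  have hdiff : DifferentiableOn ℝ u (Metric.ball (0:ℂ) R₀ \ Set.range fun i => z i 1) :=
    fun x hx => (hderiv x hx.1 (hne x hx.2)).1.differentiableWithinAt
  have hκ := h.κ_pos
  have hκ1 : √κ < 1 := (Real.sqrt_lt' one_pos).2 (by linarith [h.κ_lt])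
  refine ⟨fun i => z i lam, √κ, C / 2 * MeasureTheory.volume.real (Metric.ball (0:ℂ) R₀), u,
    fun i => hsub i (Metric.mem_closedBall_self (hL0 i)), Real.sqrt_pos.2 hκ, hκ1,
    h.cavityMap_injOn hφ, hdiff, fun p hp hp2 => ⟨?_, ?_⟩, fun s hs hsa => ?_, fun x hx => ?_, ?_,
    fun ε hε hεκ => ?_, fun ε hε hεκ => ?_⟩
  · exact h.integrableOn_norm_cavityMap_rpow hφ hdiff.continuousOn (by linarith)
  · exact integrableOn_sqrt_rpow_of_le_singular hp hp2 hm hC0 hfm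
      fun x hx hxa => (hderiv x hx hxa).2.2
  · exact integrableOn_of_le_singular hs hm hfm hf0 (fun x hx => hne x (hsa hx).2)
      fun x hx => (hderiv x (hsa hx).1 (hne x (hsa hx).2)).2.2
  · exact h.cavityMap_sphere hφ (by rw [Complex.normSq_eq_norm_sq, mem_sphere_zero_iff_norm.1 hx])
  · filter_upwards [MeasureTheory.ae_all_iff.2 fun i =>
      MeasureTheory.Measure.ae_ne MeasureTheory.volume (z i 1)] with x hxa hx
    exact ⟨(hderiv x hx hxa).1, (hderiv x hx hxa).2.1⟩
  · have hmv : ∀ i, v i / Real.pi = L i lam ^ 2 := fun i => by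
      rw [← hLv i, mul_div_cancel_left₀ _ Real.pi_ne_zero]
    simp only [hmv]
    exact h.image_cavityMap hφ hε (by
      have := (Real.le_sqrt hε.le hκ.le).1 hεκ
      linarith)
  · have hvm : ∑ i, v i = ∑ i, Real.pi * L i lam ^ 2 := Finset.sum_congr rfl fun i _ => (hLv i).symm
    rw [hvm]
    exact setIntegral_half_le_of_le_singular hm hC0 hf0 hε (hεκ.trans hκ1.le)
      fun x hx hxa => (hderiv x hx hxa).2.2
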